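/- arXiv:1603.02820 — 7 statements merged into one kernel-verified Lean document; each statement's English description precedes it below -/
import Mathlib

section
/- Let (γ, T, W₁, N, W₂, η, k₁, k₂) be a Cartan framed null variation and let V(σ) = ∂γ/∂t(σ,0). Then: (i) ⟨∂²γ/∂t∂σ(σ,t), ∂γ/∂σ(σ,t)⟩ = 0 for all (σ,t) ∈ I × J (the variation vector field locally preserves the causal character); and (ii) ∂η/∂t(σ,0) = −(1/(2a))·ρ_V(σ) for all σ ∈ I, where ρ_V(σ) = −ε₁⟨∂²V/∂σ²(σ), W₁(σ,0)⟩. -/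
noncomputable section

/-- Vectors of `ℝ⁴`. -/
abbrev V4 : Type := Fin 4 → ℝ

/-- A Cartan framed null variation in the flat pseudo-Euclidean `ℝ⁴` with symmetric
bilinear form `B`, constant `a` and signs `ε₁`, `ε₂`: smooth maps
`γ, T, W₁, N, W₂ : I × J → ℝ⁴`, a smooth positive function `η` with `η(·,0) = 1` and
`∂γ/∂σ = η T`, smooth curvatures `k₁, k₂`, such that the frame relations and the Cartan
equations hold at every point of `I × J`. -/
structure CartanVariation (B : V4 →ₗ[ℝ] V4 →ₗ[ℝ] ℝ) (a ε₁ ε₂ : ℝ) where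
  I : Set ℝ
  J : Set ℝ
  I_open : IsOpen I
  J_open : IsOpen J
  I_conn : I.OrdConnected
  J_conn : J.OrdConnected
  I_ne : I.Nonempty
  J_zero : (0 : ℝ) ∈ J
  γ : ℝ → ℝ → V4
  T : ℝ → ℝ → V4
  W₁ : ℝ → ℝ → V4
  N : ℝ → ℝ → V4
  W₂ : ℝ → ℝ → V4
  η : ℝ → ℝ → ℝ
  k₁ : ℝ → ℝ → ℝ
  k₂ : ℝ → ℝ → ℝ
  smooth_γ : ContDiffOn ℝ (⊤ : ℕ∞) (fun p : ℝ × ℝ => γ p.1 p.2) (I ×ˢ J)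
  smooth_T : ContDiffOn ℝ (⊤ : ℕ∞) (fun p : ℝ × ℝ => T p.1 p.2) (I ×ˢ J)
  smooth_W₁ : ContDiffOn ℝ (⊤ : ℕ∞) (fun p : ℝ × ℝ => W₁ p.1 p.2) (I ×ˢ J)
  smooth_N : ContDiffOn ℝ (⊤ : ℕ∞) (fun p : ℝ × ℝ => N p.1 p.2) (I ×ˢ J)
  smooth_W₂ : ContDiffOn ℝ (⊤ : ℕ∞) (fun p : ℝ × ℝ => W₂ p.1 p.2) (I ×ˢ J)
  smooth_η : ContDiffOn ℝ (⊤ : ℕ∞) (fun p : ℝ × ℝ => η p.1 p.2) (I ×ˢ J)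
  smooth_k₁ : ContDiffOn ℝ (⊤ : ℕ∞) (fun p : ℝ × ℝ => k₁ p.1 p.2) (I ×ˢ J)
  smooth_k₂ : ContDiffOn ℝ (⊤ : ℕ∞) (fun p : ℝ × ℝ => k₂ p.1 p.2) (I ×ˢ J)
  η_pos : ∀ σ ∈ I, ∀ t ∈ J, 0 < η σ t
  η_one : ∀ σ ∈ I, η σ 0 = 1
  γ_deriv : ∀ σ ∈ I, ∀ t ∈ J, deriv (fun s => γ s t) σ = η σ t • T σ t
  B_TT : ∀ σ ∈ I, ∀ t ∈ J, B (T σ t) (T σ t) = 0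
  B_NN : ∀ σ ∈ I, ∀ t ∈ J, B (N σ t) (N σ t) = 0
  B_TN : ∀ σ ∈ I, ∀ t ∈ J, B (T σ t) (N σ t) = -1
  B_W₁T : ∀ σ ∈ I, ∀ t ∈ J, B (W₁ σ t) (T σ t) = 0
  B_W₁N : ∀ σ ∈ I, ∀ t ∈ J, B (W₁ σ t) (N σ t) = 0
  B_W₂T : ∀ σ ∈ I, ∀ t ∈ J, B (W₂ σ t) (T σ t) = 0
  B_W₂N : ∀ σ ∈ I, ∀ t ∈ J, B (W₂ σ t) (N σ t) = 0
  B_W₁W₂ : ∀ σ ∈ I, ∀ t ∈ J, B (W₁ σ t) (W₂ σ t) = 0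
  B_W₁W₁ : ∀ σ ∈ I, ∀ t ∈ J, B (W₁ σ t) (W₁ σ t) = ε₁
  B_W₂W₂ : ∀ σ ∈ I, ∀ t ∈ J, B (W₂ σ t) (W₂ σ t) = ε₂
  cartan_T : ∀ σ ∈ I, ∀ t ∈ J,
    deriv (fun s => T s t) σ = η σ t • (a • W₁ σ t)
  cartan_W₁ : ∀ σ ∈ I, ∀ t ∈ J,
    deriv (fun s => W₁ s t) σ = η σ t • ((-(k₁ σ t)) • T σ t + (a * ε₁) • N σ t)
  cartan_N : ∀ σ ∈ I, ∀ t ∈ J,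
    deriv (fun s => N s t) σ =
      η σ t • ((-(ε₁ * k₁ σ t)) • W₁ σ t + (ε₂ * k₂ σ t) • W₂ σ t)
  cartan_W₂ : ∀ σ ∈ I, ∀ t ∈ J,
    deriv (fun s => W₂ s t) σ = η σ t • (k₂ σ t • T σ t)

namespace CartanVariation

variable {B : V4 →ₗ[ℝ] V4 →ₗ[ℝ] ℝ} {a ε₁ ε₂ : ℝ}

/-- The variation vector field `V(σ) = ∂γ/∂t (σ, 0)`. -/
def Vf (CV : CartanVariation B a ε₁ ε₂) : ℝ → V4 :=
  fun s => deriv (fun u => CV.γ s u) 0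

/-- `φ_V = ε₁⟨V′, W₁⟩` along `t = 0`. -/
def phiV (CV : CartanVariation B a ε₁ ε₂) : ℝ → ℝ :=
  fun s => ε₁ * B (deriv CV.Vf s) (CV.W₁ s 0)

/-- `ψ_V = ε₂⟨V′, W₂⟩` along `t = 0`. -/
def psiV (CV : CartanVariation B a ε₁ ε₂) : ℝ → ℝ :=
  fun s => ε₂ * B (deriv CV.Vf s) (CV.W₂ s 0)

/-- `ρ_V = −ε₁⟨V″, W₁⟩` along `t = 0`. -/
def rhoV (CV : CartanVariation B a ε₁ ε₂) : ℝ → ℝ :=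
  fun s => -ε₁ * B (deriv (deriv CV.Vf) s) (CV.W₁ s 0)

/-- `α_V = (1/a)(φ_V′ + ρ_V/2)`. -/
def alphaV (CV : CartanVariation B a ε₁ ε₂) : ℝ → ℝ :=
  fun s => (1 / a) * (deriv CV.phiV s + CV.rhoV s / 2)

/-- `β_V = (1/a)(α_V′ + k₁φ_V − k₂ψ_V)` (case `G = 0`). -/
def betaV (CV : CartanVariation B a ε₁ ε₂) : ℝ → ℝ :=
  fun s => (1 / a) * (deriv CV.alphaV s + CV.k₁ s 0 * CV.phiV s - CV.k₂ s 0 * CV.psiV s)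

/-- `δ_V = (1/a)ψ_V″ + k₁ψ_V + ε₁ε₂k₂φ_V`. -/
def deltaV (CV : CartanVariation B a ε₁ ε₂) : ℝ → ℝ :=
  fun s => (1 / a) * deriv (deriv CV.psiV) s + CV.k₁ s 0 * CV.psiV s
    + ε₁ * ε₂ * CV.k₂ s 0 * CV.phiV s

end CartanVariation

section Partials

variable {E : Type*} [NormedAddCommGroup E] [NormedSpace ℝ E] {F : ℝ × ℝ → E} {s t : ℝ}

theorem hasDerivAt_slice_fst (h : DifferentiableAt ℝ F (s, t)) :
    HasDerivAt (fun x => F (x, t)) (fderiv ℝ F (s, t) (1, 0)) s :=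
  h.hasFDerivAt.comp_hasDerivAt s ((hasDerivAt_id s).prodMk (hasDerivAt_const s t))

theorem hasDerivAt_slice_snd (h : DifferentiableAt ℝ F (s, t)) :
    HasDerivAt (fun y => F (s, y)) (fderiv ℝ F (s, t) (0, 1)) t :=
  h.hasFDerivAt.comp_hasDerivAt t ((hasDerivAt_const t s).prodMk (hasDerivAt_id t))

theorem eventually_deriv_slices_eq (h : ContDiffAt ℝ 2 F (s, t)) :
    ∀ᶠ q : ℝ × ℝ in nhds (s, t),
      deriv (fun x => F (x, q.2)) q.1 = fderiv ℝ F q (1, 0) ∧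
      deriv (fun y => F (q.1, y)) q.2 = fderiv ℝ F q (0, 1) := by
  filter_upwards [h.eventually (by simp)] with q hq
  have hd : DifferentiableAt ℝ F (q.1, q.2) := hq.differentiableAt (by simp)
  exact ⟨(hasDerivAt_slice_fst hd).deriv, (hasDerivAt_slice_snd hd).deriv⟩

theorem differentiableAt_fderiv_of_contDiffAt_two (h : ContDiffAt ℝ 2 F (s, t)) :
    DifferentiableAt ℝ (fderiv ℝ F) (s, t) :=
  (h.fderiv_right (m := 1) (by norm_num)).differentiableAt (by simp)

theorem hasDerivAt_deriv_fst_snd (h : ContDiffAt ℝ 2 F (s, t)) :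
    HasDerivAt (fun y => deriv (fun x => F (x, y)) s)
      (fderiv ℝ (fderiv ℝ F) (s, t) (0, 1) (1, 0)) t := by
  have h1 := (hasDerivAt_slice_snd (differentiableAt_fderiv_of_contDiffAt_two h)).clm_apply
    (hasDerivAt_const t ((1, 0) : ℝ × ℝ))
  simp only [map_zero, add_zero] at h1
  refine h1.congr_of_eventuallyEq ?_
  have hc : Filter.Tendsto (fun y : ℝ => (s, y)) (nhds t) (nhds (s, t)) :=
    (Continuous.prodMk_right s).tendsto t
  filter_upwards [hc.eventually (eventually_deriv_slices_eq h)] with y hy using hy.1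

theorem hasDerivAt_deriv_snd_fst (h : ContDiffAt ℝ 2 F (s, t)) :
    HasDerivAt (fun x => deriv (fun y => F (x, y)) t)
      (fderiv ℝ (fderiv ℝ F) (s, t) (1, 0) (0, 1)) s := by
  have h1 := (hasDerivAt_slice_fst (differentiableAt_fderiv_of_contDiffAt_two h)).clm_apply
    (hasDerivAt_const s ((0, 1) : ℝ × ℝ))
  simp only [map_zero, add_zero] at h1
  refine h1.congr_of_eventuallyEq ?_
  have hc : Filter.Tendsto (fun x : ℝ => (x, t)) (nhds s) (nhds (s, t)) :=
    (Continuous.prodMk_left t).tendsto s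
  filter_upwards [hc.eventually (eventually_deriv_slices_eq h)] with x hx using hx.2

/-- Mixed partial derivatives of a `C²` map on the plane commute. -/
theorem deriv_deriv_comm (h : ContDiffAt ℝ 2 F (s, t)) :
    deriv (fun x => deriv (fun y => F (x, y)) t) s =
      deriv (fun y => deriv (fun x => F (x, y)) s) t := by
  rw [(hasDerivAt_deriv_snd_fst h).deriv, (hasDerivAt_deriv_fst_snd h).deriv]
  exact (h.isSymmSndFDerivAt (by simp)).eq _ _

end Partials

theorem LinearMap.hasDerivAt_bilin {E : Type*} [NormedAddCommGroup E] [NormedSpace ℝ E]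
    [FiniteDimensional ℝ E] (B : E →ₗ[ℝ] E →ₗ[ℝ] ℝ) {f g : ℝ → E}
    {f' g' : E} {t : ℝ} (hf : HasDerivAt f f' t) (hg : HasDerivAt g g' t) :
    HasDerivAt (fun u => B (f u) (g u)) (B f' (g t) + B (f t) g') t := by
  let C : E →L[ℝ] E →L[ℝ] ℝ :=
    LinearMap.toContinuousLinearMap
      ((LinearMap.toContinuousLinearMap (𝕜 := ℝ) (E := E) (F' := ℝ)).toLinearMap ∘ₗ B)
  have h := (C.hasFDerivAt.comp_hasDerivAt t hf).clm_apply hg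
  exact h

/-- If `⟨f, f⟩` is locally constant, then `⟨f', f⟩ = 0`. -/
theorem LinearMap.apply_deriv_self_eq_zero {E : Type*} [NormedAddCommGroup E] [NormedSpace ℝ E]
    [FiniteDimensional ℝ E] (B : E →ₗ[ℝ] E →ₗ[ℝ] ℝ)
    (hB : ∀ v w, B v w = B w v) {f : ℝ → E} {f' : E} {t c : ℝ} (hf : HasDerivAt f f' t)
    (hc : ∀ᶠ u in nhds t, B (f u) (f u) = c) : B f' (f t) = 0 := by
  have h1 := B.hasDerivAt_bilin hf hf
  have h2 : HasDerivAt (fun u => B (f u) (f u)) 0 t :=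
    (hasDerivAt_const t c).congr_of_eventuallyEq hc
  have h3 := h1.unique h2
  rw [hB (f t) f'] at h3
  linarith

namespace CartanVariation

variable {B : V4 →ₗ[ℝ] V4 →ₗ[ℝ] ℝ} {a ε₁ ε₂ : ℝ}

theorem contDiffAt_two (CV : CartanVariation B a ε₁ ε₂) {E : Type*} [NormedAddCommGroup E]
    [NormedSpace ℝ E] {F : ℝ × ℝ → E} (hF : ContDiffOn ℝ (⊤ : ℕ∞) F (CV.I ×ˢ CV.J)) {s t : ℝ}
    (hs : s ∈ CV.I) (ht : t ∈ CV.J) : ContDiffAt ℝ 2 F (s, t) :=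
  (hF.contDiffAt ((CV.I_open.prod CV.J_open).mem_nhds ⟨hs, ht⟩)).of_le
    (WithTop.coe_le_coe.2 le_top)

theorem bilin_deriv_velocity (CV : CartanVariation B a ε₁ ε₂) (hB : ∀ v w, B v w = B w v)
    {s t : ℝ} (hs : s ∈ CV.I) (ht : t ∈ CV.J) :
    B (deriv (fun u => deriv (fun x => CV.γ x u) s) t) (deriv (fun x => CV.γ x t) s) = 0 := by
  have hd := (hasDerivAt_deriv_fst_snd (CV.contDiffAt_two CV.smooth_γ hs ht)).differentiableAt
  refine B.apply_deriv_self_eq_zero hB (f := fun u => deriv (fun x => CV.γ x u) s)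
    hd.hasDerivAt (c := 0) ?_
  filter_upwards [CV.J_open.mem_nhds ht] with u hu
  simp [CV.γ_deriv s hs u hu, CV.B_TT s hs u hu]

theorem smooth_velocity (CV : CartanVariation B a ε₁ ε₂) :
    ContDiffOn ℝ (⊤ : ℕ∞) (fun p : ℝ × ℝ => CV.η p.1 p.2 • CV.T p.1 p.2) (CV.I ×ˢ CV.J) :=
  CV.smooth_η.smul CV.smooth_T

theorem deriv_Vf (CV : CartanVariation B a ε₁ ε₂) {s : ℝ} (hs : s ∈ CV.I) :
    deriv CV.Vf s = deriv (fun u => CV.η s u • CV.T s u) 0 := by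
  have h := deriv_deriv_comm (CV.contDiffAt_two CV.smooth_γ hs CV.J_zero)
  refine h.trans (Filter.EventuallyEq.deriv_eq ?_)
  filter_upwards [CV.J_open.mem_nhds CV.J_zero] with u hu using CV.γ_deriv s hs u hu

theorem deriv_velocity (CV : CartanVariation B a ε₁ ε₂) {s t : ℝ} (hs : s ∈ CV.I)
    (ht : t ∈ CV.J) :
    deriv (fun x => CV.η x t • CV.T x t) s =
      deriv (fun x => CV.η x t) s • CV.T s t + (a * CV.η s t ^ 2) • CV.W₁ s t := by
  have hη := (hasDerivAt_slice_fst
    ((CV.contDiffAt_two CV.smooth_η hs ht).differentiableAt (by simp))).differentiableAt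
  have hT := (hasDerivAt_slice_fst
    ((CV.contDiffAt_two CV.smooth_T hs ht).differentiableAt (by simp))).differentiableAt
  refine (hη.hasDerivAt.smul hT.hasDerivAt).deriv.trans ?_
  rw [CV.cartan_T s hs t ht]
  module

theorem deriv_deriv_Vf (CV : CartanVariation B a ε₁ ε₂) {s : ℝ} (hs : s ∈ CV.I) :
    deriv (deriv CV.Vf) s =
      deriv (fun u => deriv (fun x => CV.η x u) s • CV.T s u
        + (a * CV.η s u ^ 2) • CV.W₁ s u) 0 := by
  have h1 : deriv CV.Vf =ᶠ[nhds s] fun x => deriv (fun u => CV.η x u • CV.T x u) 0 := by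
    filter_upwards [CV.I_open.mem_nhds hs] with x hx using CV.deriv_Vf hx
  rw [h1.deriv_eq]
  have h := deriv_deriv_comm (CV.contDiffAt_two CV.smooth_velocity hs CV.J_zero)
  refine h.trans (Filter.EventuallyEq.deriv_eq ?_)
  filter_upwards [CV.J_open.mem_nhds CV.J_zero] with u hu using CV.deriv_velocity hs hu

theorem deriv_η_fst_zero (CV : CartanVariation B a ε₁ ε₂) {s : ℝ} (hs : s ∈ CV.I) :
    deriv (fun x => CV.η x 0) s = 0 := by
  have h : (fun x => CV.η x 0) =ᶠ[nhds s] fun _ => 1 := by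
    filter_upwards [CV.I_open.mem_nhds hs] with x hx using CV.η_one x hx
  rw [h.deriv_eq, deriv_const]

theorem bilin_deriv_deriv_Vf (CV : CartanVariation B a ε₁ ε₂) (hB : ∀ v w, B v w = B w v)
    {s : ℝ} (hs : s ∈ CV.I) :
    B (deriv (deriv CV.Vf) s) (CV.W₁ s 0) = 2 * a * ε₁ * deriv (fun u => CV.η s u) 0 := by
  have h0 := CV.J_zero
  have hησ := (hasDerivAt_deriv_fst_snd
    (CV.contDiffAt_two CV.smooth_η hs h0)).differentiableAt.hasDerivAt
  have hη := (hasDerivAt_slice_snd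
    ((CV.contDiffAt_two CV.smooth_η hs h0).differentiableAt
      (by simp))).differentiableAt.hasDerivAt
  have hT := (hasDerivAt_slice_snd
    ((CV.contDiffAt_two CV.smooth_T hs h0).differentiableAt
      (by simp))).differentiableAt.hasDerivAt
  have hW := (hasDerivAt_slice_snd
    ((CV.contDiffAt_two CV.smooth_W₁ hs h0).differentiableAt
      (by simp))).differentiableAt.hasDerivAt
  have hWW := B.apply_deriv_self_eq_zero hB hW (c := ε₁) (by
    filter_upwards [CV.J_open.mem_nhds h0] with u hu using CV.B_W₁W₁ s hs u hu)
  have hd := (hησ.smul hT).add (((hη.pow 2).const_mul a).smul hW)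
  rw [CV.deriv_deriv_Vf hs]
  refine (congrArg (fun v => B v (CV.W₁ s 0)) hd.deriv).trans ?_
  have hTW : B (CV.T s 0) (CV.W₁ s 0) = 0 := (hB _ _).trans (CV.B_W₁T s hs 0 h0)
  simp only [map_add, map_smul, LinearMap.add_apply, LinearMap.smul_apply, smul_eq_mul,
    CV.deriv_η_fst_zero hs, hWW, hTW, CV.B_W₁W₁ s hs 0 h0, Pi.pow_apply, CV.η_one s hs]
  ring

end CartanVariation

open CartanVariation in
/-- For a null variation: (i) the variation vector field locally
preserves the causal character, `⟨∂²γ/∂t∂σ, ∂γ/∂σ⟩ = 0`; and (ii)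
`∂η/∂t(σ,0) = −(1/(2a))·ρ_V(σ)` where `ρ_V = −ε₁⟨V″, W₁⟩`. -/
theorem stmt2 (B : V4 →ₗ[ℝ] V4 →ₗ[ℝ] ℝ) (hB : ∀ v w, B v w = B w v)
    (a ε₁ ε₂ : ℝ) (ha : 0 < a) (hε₁ : ε₁ = 1 ∨ ε₁ = -1) (hε₂ : ε₂ = 1 ∨ ε₂ = -1)
    (CV : CartanVariation B a ε₁ ε₂) :
    (∀ σ ∈ CV.I, ∀ t ∈ CV.J,
      B (deriv (fun u => deriv (fun s => CV.γ s u) σ) t)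
        (deriv (fun s => CV.γ s t) σ) = 0) ∧
    (∀ σ ∈ CV.I,
      deriv (fun u => CV.η σ u) 0 = -(1 / (2 * a)) * CV.rhoV σ) := by
  refine ⟨fun σ hσ t ht => CV.bilin_deriv_velocity hB hσ ht, fun σ hσ => ?_⟩
  have hε : ε₁ * ε₁ = 1 := by rcases hε₁ with rfl | rfl <;> norm_num
  rw [rhoV, CV.bilin_deriv_deriv_Vf hB hσ]
  field_simp
  linear_combination (-deriv (fun u => CV.η σ u) 0) * hε
end
end

section
/- Let (γ, T, W₁, N, W₂, η, k₁, k₂) be a Cartan framed null variation, let V(σ) = ∂γ/∂t(σ,0), and along t = 0 set (with ′ = ∂/∂σ evaluated at t = 0) φ_V = ε₁⟨V′, W₁⟩, ψ_V = ε₂⟨V′, W₂⟩, ρ_V = −ε₁⟨V″, W₁⟩. Then for all σ ∈ I (with k₁, k₂ evaluated at (σ,0)): ∂k₁/∂t(σ,0) = (1/a²)φ_V‴ + (1/a)((k₁φ_V)′ + k₁φ_V′) − (1/a)((k₂ψ_V)′ + k₂ψ_V′) + (1/a)((1/(2a))ρ_V″ + k₁ρ_V), and ∂k₂/∂t(σ,0)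 = (ε₁ε₂/a²)ψ_V‴ + (ε₁ε₂/a)((k₁ψ_V)′ + k₁ψ_V′) + (1/a)((k₂φ_V)′ + k₂φ_V′) + (1/a)k₂ρ_V. -/
noncomputable section

section PlanarSlices

variable {E : Type*} [NormedAddCommGroup E] [NormedSpace ℝ E] {X : ℝ → ℝ → E} {I J : Set ℝ}
  {s t : ℝ}

theorem HasFDerivAt.hasDerivAt_slice_fst {F : ℝ × ℝ →L[ℝ] E}
    (h : HasFDerivAt (fun p : ℝ × ℝ => X p.1 p.2) F (s, t)) :
    HasDerivAt (fun s => X s t) (F (1, 0)) s :=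
  h.comp_hasDerivAt (f := fun s => (s, t)) s ((hasDerivAt_id s).prodMk (hasDerivAt_const s t))

theorem HasFDerivAt.hasDerivAt_slice_snd {F : ℝ × ℝ →L[ℝ] E}
    (h : HasFDerivAt (fun p : ℝ × ℝ => X p.1 p.2) F (s, t)) :
    HasDerivAt (fun u => X s u) (F (0, 1)) t :=
  h.comp_hasDerivAt (f := fun u => (s, u)) t ((hasDerivAt_const t s).prodMk (hasDerivAt_id t))

theorem ContDiffOn.hasFDerivAt_uncurried
    (hX : ContDiffOn ℝ (⊤ : ℕ∞) (fun p : ℝ × ℝ => X p.1 p.2) (I ×ˢ J))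
    (hI : IsOpen I) (hJ : IsOpen J) (hs : s ∈ I) (ht : t ∈ J) :
    HasFDerivAt (fun p : ℝ × ℝ => X p.1 p.2)
      (fderiv ℝ (fun p : ℝ × ℝ => X p.1 p.2) (s, t)) (s, t) :=
  ((hX.contDiffAt ((hI.prod hJ).mem_nhds ⟨hs, ht⟩)).differentiableAt (by simp)).hasFDerivAt

theorem ContDiffOn.slice_fst
    (hX : ContDiffOn ℝ (⊤ : ℕ∞) (fun p : ℝ × ℝ => X p.1 p.2) (I ×ˢ J)) (ht : t ∈ J) :
    ContDiffOn ℝ (⊤ : ℕ∞) (fun s => X s t) I :=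
  hX.comp (f := fun s => (s, t)) (by fun_prop) fun _ hs => ⟨hs, ht⟩

theorem ContDiffOn.hasDerivAt_slice_snd
    (hX : ContDiffOn ℝ (⊤ : ℕ∞) (fun p : ℝ × ℝ => X p.1 p.2) (I ×ˢ J))
    (hI : IsOpen I) (hJ : IsOpen J) (hs : s ∈ I) (ht : t ∈ J) :
    HasDerivAt (fun u => X s u) (deriv (fun u => X s u) t) t :=
  (hX.hasFDerivAt_uncurried hI hJ hs ht).hasDerivAt_slice_snd.differentiableAt.hasDerivAt

theorem ContDiffOn.deriv_slice_snd
    (hX : ContDiffOn ℝ (⊤ : ℕ∞) (fun p : ℝ × ℝ => X p.1 p.2) (I ×ˢ J))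
    (hI : IsOpen I) (hJ : IsOpen J) (ht : t ∈ J) :
    ContDiffOn ℝ (⊤ : ℕ∞) (fun s => deriv (fun u => X s u) t) I := by
  have h : ContDiffOn ℝ (⊤ : ℕ∞) (fderiv ℝ (fun p : ℝ × ℝ => X p.1 p.2)) (I ×ˢ J) :=
    hX.fderiv_of_isOpen (hI.prod hJ) (by simp)
  have h' : ContDiffOn ℝ (⊤ : ℕ∞)
      (fun s => fderiv ℝ (fun p : ℝ × ℝ => X p.1 p.2) (s, t) (0, 1)) I :=
    (h.comp (f := fun s => (s, t)) (by fun_prop) fun _ hs => ⟨hs, ht⟩).clm_apply contDiffOn_const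
  exact h'.congr fun s hs =>
    (hX.hasFDerivAt_uncurried hI hJ hs ht).hasDerivAt_slice_snd.deriv

/-- The two partial derivatives of a smooth map of two real variables commute. -/
theorem ContDiffOn.deriv_deriv_slice_comm
    (hX : ContDiffOn ℝ (⊤ : ℕ∞) (fun p : ℝ × ℝ => X p.1 p.2) (I ×ˢ J))
    (hI : IsOpen I) (hJ : IsOpen J) (hs : s ∈ I) (ht : t ∈ J) :
    deriv (fun s => deriv (fun u => X s u) t) s = deriv (fun u => deriv (fun s => X s u) s) t := by
  set F : ℝ × ℝ → ℝ × ℝ →L[ℝ] E := fderiv ℝ (fun p : ℝ × ℝ => X p.1 p.2)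
  have h : ContDiffOn ℝ (⊤ : ℕ∞) F (I ×ˢ J) := hX.fderiv_of_isOpen (hI.prod hJ) (by simp)
  have hmem : I ×ˢ J ∈ nhds (s, t) := (hI.prod hJ).mem_nhds ⟨hs, ht⟩
  have hd : HasFDerivAt (fun p : ℝ × ℝ => F (p.1, p.2)) (fderiv ℝ F (s, t)) (s, t) :=
    ((h.contDiffAt hmem).differentiableAt (by simp)).hasFDerivAt
  have hsymm : IsSymmSndFDerivAt ℝ (fun p : ℝ × ℝ => X p.1 p.2) (s, t) :=
    (hX.contDiffAt hmem).isSymmSndFDerivAt (by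
      rw [minSmoothness_of_isRCLikeNormedField]; exact WithTop.coe_le_coe.2 (le_top : (2 : ℕ∞) ≤ ⊤))
  have hl : (fun s => deriv (fun u => X s u) t) =ᶠ[nhds s] fun s => F (s, t) (0, 1) := by
    filter_upwards [hI.mem_nhds hs] with s' hs'
    exact (hX.hasFDerivAt_uncurried hI hJ hs' ht).hasDerivAt_slice_snd.deriv
  have hr : (fun u => deriv (fun s => X s u) s) =ᶠ[nhds t] fun u => F (s, u) (1, 0) := by
    filter_upwards [hJ.mem_nhds ht] with t' ht'
    exact (hX.hasFDerivAt_uncurried hI hJ hs ht').hasDerivAt_slice_fst.deriv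
  have hl' := (hd.hasDerivAt_slice_fst (X := fun s t => F (s, t))).clm_apply
    (hasDerivAt_const s ((0, 1) : ℝ × ℝ))
  have hr' := (hd.hasDerivAt_slice_snd (X := fun s t => F (s, t))).clm_apply
    (hasDerivAt_const t ((1, 0) : ℝ × ℝ))
  rw [hl.deriv_eq, hr.deriv_eq, hl'.deriv, hr'.deriv]
  simpa using hsymm (1, 0) (0, 1)

end PlanarSlices

theorem LinearMap.hasDerivAt_bilin_s4 (B : V4 →ₗ[ℝ] V4 →ₗ[ℝ] ℝ) {x y : ℝ → V4} {x' y' : V4}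
    {s : ℝ} (hx : HasDerivAt x x' s) (hy : HasDerivAt y y' s) :
    HasDerivAt (fun s => B (x s) (y s)) (B x' (y s) + B (x s) y') s := by
  simpa [add_comm] using B.toContinuousBilinearMap.hasDerivAt_of_bilinear
    (fun _ => hx) (fun _ => hy)

theorem LinearMap.contDiffOn_bilin (B : V4 →ₗ[ℝ] V4 →ₗ[ℝ] ℝ) {x y : ℝ → V4} {I : Set ℝ}
    (hx : ContDiffOn ℝ (⊤ : ℕ∞) x I) (hy : ContDiffOn ℝ (⊤ : ℕ∞) y I) :
    ContDiffOn ℝ (⊤ : ℕ∞) (fun s => B (x s) (y s)) I :=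
  (B.toContinuousBilinearMap.contDiff.comp_contDiffOn hx).clm_apply hy

namespace CartanVariation

/-- The derivative of `X` in the variation parameter, along `t = 0`. -/
def varDeriv {E : Type*} [NormedAddCommGroup E] [NormedSpace ℝ E] (X : ℝ → ℝ → E) : ℝ → E :=
  fun s => deriv (fun u => X s u) 0

variable {B : V4 →ₗ[ℝ] V4 →ₗ[ℝ] ℝ} {a ε₁ ε₂ : ℝ} (CV : CartanVariation B a ε₁ ε₂) {s : ℝ}

section Calculus

variable {E : Type*} [NormedAddCommGroup E] [NormedSpace ℝ E] {Z : ℝ → ℝ → E} {f : ℝ → E} {z : E}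
  {X Y : ℝ → ℝ → V4} {c : ℝ}

theorem contDiffOn_varDeriv
    (hZ : ContDiffOn ℝ (⊤ : ℕ∞) (fun p : ℝ × ℝ => Z p.1 p.2) (CV.I ×ˢ CV.J)) :
    ContDiffOn ℝ (⊤ : ℕ∞) (varDeriv Z) CV.I :=
  hZ.deriv_slice_snd CV.I_open CV.J_open CV.J_zero

theorem hasDerivAt_varDeriv
    (hZ : ContDiffOn ℝ (⊤ : ℕ∞) (fun p : ℝ × ℝ => Z p.1 p.2) (CV.I ×ˢ CV.J)) (hs : s ∈ CV.I) :
    HasDerivAt (fun u => Z s u) (varDeriv Z s) 0 :=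
  hZ.hasDerivAt_slice_snd CV.I_open CV.J_open hs CV.J_zero

theorem differentiableAt_of_contDiffOn (hf : ContDiffOn ℝ (⊤ : ℕ∞) f CV.I) (hs : s ∈ CV.I) :
    DifferentiableAt ℝ f s :=
  (hf.contDiffAt (CV.I_open.mem_nhds hs)).differentiableAt (by simp)

theorem contDiffOn_deriv (hf : ContDiffOn ℝ (⊤ : ℕ∞) f CV.I) :
    ContDiffOn ℝ (⊤ : ℕ∞) (deriv f) CV.I :=
  hf.deriv_of_isOpen CV.I_open (by simp)

theorem deriv_varDeriv
    (hZ : ContDiffOn ℝ (⊤ : ℕ∞) (fun p : ℝ × ℝ => Z p.1 p.2) (CV.I ×ˢ CV.J)) (hs : s ∈ CV.I)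
    (hf : ∀ t ∈ CV.J, deriv (fun s => Z s t) s = f t) (hz : HasDerivAt f z 0) :
    deriv (varDeriv Z) s = z := by
  have h : (fun u => deriv (fun s => Z s u) s) =ᶠ[nhds 0] f := by
    filter_upwards [CV.J_open.mem_nhds CV.J_zero] with t ht using hf t ht
  exact (hZ.deriv_deriv_slice_comm CV.I_open CV.J_open hs CV.J_zero).trans
    (h.deriv_eq.trans hz.deriv)

theorem contDiffOn_pairing
    (hX : ContDiffOn ℝ (⊤ : ℕ∞) (fun p : ℝ × ℝ => X p.1 p.2) (CV.I ×ˢ CV.J))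
    (hY : ContDiffOn ℝ (⊤ : ℕ∞) (fun p : ℝ × ℝ => Y p.1 p.2) (CV.I ×ˢ CV.J)) :
    ContDiffOn ℝ (⊤ : ℕ∞) (fun s => B (varDeriv X s) (Y s 0)) CV.I :=
  B.contDiffOn_bilin (CV.contDiffOn_varDeriv hX) (hY.slice_fst CV.J_zero)

theorem deriv_pairing
    (hX : ContDiffOn ℝ (⊤ : ℕ∞) (fun p : ℝ × ℝ => X p.1 p.2) (CV.I ×ˢ CV.J))
    (hY : ContDiffOn ℝ (⊤ : ℕ∞) (fun p : ℝ × ℝ => Y p.1 p.2) (CV.I ×ˢ CV.J)) (hs : s ∈ CV.I) :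
    deriv (fun s => B (varDeriv X s) (Y s 0)) s =
      B (deriv (varDeriv X) s) (Y s 0) + B (varDeriv X s) (deriv (fun s => Y s 0) s) :=
  (B.hasDerivAt_bilin_s4
    (CV.differentiableAt_of_contDiffOn (CV.contDiffOn_varDeriv hX) hs).hasDerivAt
    (CV.differentiableAt_of_contDiffOn (hY.slice_fst CV.J_zero) hs).hasDerivAt).deriv

theorem varDeriv_pairing_of_const
    (hX : ContDiffOn ℝ (⊤ : ℕ∞) (fun p : ℝ × ℝ => X p.1 p.2) (CV.I ×ˢ CV.J))
    (hY : ContDiffOn ℝ (⊤ : ℕ∞) (fun p : ℝ × ℝ => Y p.1 p.2) (CV.I ×ˢ CV.J))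
    (hc : ∀ σ ∈ CV.I, ∀ t ∈ CV.J, B (X σ t) (Y σ t) = c) (hs : s ∈ CV.I) :
    B (varDeriv X s) (Y s 0) + B (X s 0) (varDeriv Y s) = 0 := by
  have h : (fun u => B (X s u) (Y s u)) =ᶠ[nhds 0] fun _ => c := by
    filter_upwards [CV.J_open.mem_nhds CV.J_zero] with t ht using hc s hs t ht
  have h' := B.hasDerivAt_bilin_s4 (CV.hasDerivAt_varDeriv hX hs) (CV.hasDerivAt_varDeriv hY hs)
  rw [← h'.deriv, h.deriv_eq, deriv_const]

theorem varDeriv_self_of_const (hB : ∀ v w, B v w = B w v)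
    (hX : ContDiffOn ℝ (⊤ : ℕ∞) (fun p : ℝ × ℝ => X p.1 p.2) (CV.I ×ˢ CV.J))
    (hc : ∀ σ ∈ CV.I, ∀ t ∈ CV.J, B (X σ t) (X σ t) = c) (hs : s ∈ CV.I) :
    B (varDeriv X s) (X s 0) = 0 := by
  have := CV.varDeriv_pairing_of_const hX hX hc hs
  rw [hB (X s 0)] at this
  linarith

end Calculus

theorem deriv_Vf_s4 (hs : s ∈ CV.I) :
    deriv CV.Vf s = varDeriv CV.η s • CV.T s 0 + varDeriv CV.T s := by
  refine (CV.deriv_varDeriv CV.smooth_γ hs (CV.γ_deriv s hs)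
    ((CV.hasDerivAt_varDeriv CV.smooth_η hs).fun_smul
      (CV.hasDerivAt_varDeriv CV.smooth_T hs))).trans ?_
  rw [CV.η_one s hs, one_smul, add_comm]

theorem deriv_varDeriv_T (hs : s ∈ CV.I) :
    deriv (varDeriv CV.T) s =
      varDeriv CV.η s • (a • CV.W₁ s 0) + a • varDeriv CV.W₁ s := by
  refine (CV.deriv_varDeriv CV.smooth_T hs (CV.cartan_T s hs)
    ((CV.hasDerivAt_varDeriv CV.smooth_η hs).fun_smul
      ((CV.hasDerivAt_varDeriv CV.smooth_W₁ hs).const_smul a))).trans ?_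
  simp [CV.η_one s hs, add_comm]

theorem deriv_varDeriv_W₁ (hs : s ∈ CV.I) :
    deriv (varDeriv CV.W₁) s =
      varDeriv CV.η s • ((-(CV.k₁ s 0)) • CV.T s 0 + (a * ε₁) • CV.N s 0)
        + ((-(CV.k₁ s 0)) • varDeriv CV.T s + (-(varDeriv CV.k₁ s)) • CV.T s 0
          + (a * ε₁) • varDeriv CV.N s) := by
  refine (CV.deriv_varDeriv CV.smooth_W₁ hs (CV.cartan_W₁ s hs)
    ((CV.hasDerivAt_varDeriv CV.smooth_η hs).fun_smul
      (((CV.hasDerivAt_varDeriv CV.smooth_k₁ hs).fun_neg.fun_smul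
        (CV.hasDerivAt_varDeriv CV.smooth_T hs)).fun_add
        ((CV.hasDerivAt_varDeriv CV.smooth_N hs).fun_const_smul (a * ε₁))))).trans ?_
  rw [CV.η_one s hs, one_smul, add_comm]

theorem deriv_varDeriv_W₂ (hs : s ∈ CV.I) :
    deriv (varDeriv CV.W₂) s =
      varDeriv CV.η s • (CV.k₂ s 0 • CV.T s 0)
        + (CV.k₂ s 0 • varDeriv CV.T s + varDeriv CV.k₂ s • CV.T s 0) := by
  refine (CV.deriv_varDeriv CV.smooth_W₂ hs (CV.cartan_W₂ s hs)
    ((CV.hasDerivAt_varDeriv CV.smooth_η hs).fun_smul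
      ((CV.hasDerivAt_varDeriv CV.smooth_k₂ hs).fun_smul
        (CV.hasDerivAt_varDeriv CV.smooth_T hs)))).trans ?_
  rw [CV.η_one s hs, one_smul, add_comm]

theorem phiV_eq (hB : ∀ v w, B v w = B w v) (hs : s ∈ CV.I) :
    CV.phiV s = ε₁ * B (varDeriv CV.T s) (CV.W₁ s 0) := by
  simp [phiV, CV.deriv_Vf_s4 hs, hB (CV.T s 0), CV.B_W₁T s hs 0 CV.J_zero]

theorem psiV_eq (hB : ∀ v w, B v w = B w v) (hs : s ∈ CV.I) :
    CV.psiV s = ε₂ * B (varDeriv CV.T s) (CV.W₂ s 0) := by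
  simp [psiV, CV.deriv_Vf_s4 hs, hB (CV.T s 0), CV.B_W₂T s hs 0 CV.J_zero]

theorem rhoV_eq (hB : ∀ v w, B v w = B w v) (hε₁ : ε₁ * ε₁ = 1) (hs : s ∈ CV.I) :
    CV.rhoV s = -2 * a * varDeriv CV.η s := by
  have hη := (CV.differentiableAt_of_contDiffOn
    (CV.contDiffOn_varDeriv CV.smooth_η) hs).hasDerivAt
  have hT := (CV.differentiableAt_of_contDiffOn
    (CV.smooth_T.slice_fst CV.J_zero) hs).hasDerivAt
  have hT' := (CV.differentiableAt_of_contDiffOn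
    (CV.contDiffOn_varDeriv CV.smooth_T) hs).hasDerivAt
  have hV : deriv (deriv CV.Vf) s = _ :=
    (Set.EqOn.deriv (fun σ hσ => CV.deriv_Vf_s4 hσ) CV.I_open hs).trans
      ((hη.fun_smul hT).fun_add hT').deriv
  rw [CV.cartan_T s hs 0 CV.J_zero, CV.deriv_varDeriv_T hs, CV.η_one s hs] at hV
  have hW := CV.varDeriv_self_of_const hB CV.smooth_W₁ CV.B_W₁W₁ hs
  simp only [rhoV, hV, map_add, map_smul, LinearMap.add_apply, LinearMap.smul_apply, smul_eq_mul,
    hB (CV.T s 0), CV.B_W₁T s hs 0 CV.J_zero, CV.B_W₁W₁ s hs 0 CV.J_zero, hW]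
  linear_combination (-2 * a * varDeriv CV.η s) * hε₁

theorem pairing_T_W₁ (hB : ∀ v w, B v w = B w v) (hε₁ : ε₁ * ε₁ = 1) (hs : s ∈ CV.I) :
    B (varDeriv CV.T s) (CV.W₁ s 0) = ε₁ * CV.phiV s := by
  rw [CV.phiV_eq hB hs, ← mul_assoc, hε₁, one_mul]

theorem pairing_T_W₂ (hB : ∀ v w, B v w = B w v) (hε₂ : ε₂ * ε₂ = 1) (hs : s ∈ CV.I) :
    B (varDeriv CV.T s) (CV.W₂ s 0) = ε₂ * CV.psiV s := by
  rw [CV.psiV_eq hB hs, ← mul_assoc, hε₂, one_mul]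

theorem contDiffOn_phiV (hB : ∀ v w, B v w = B w v) :
    ContDiffOn ℝ (⊤ : ℕ∞) CV.phiV CV.I :=
  (contDiffOn_const.mul (CV.contDiffOn_pairing CV.smooth_T CV.smooth_W₁)).congr
    fun _ hσ => CV.phiV_eq hB hσ

theorem contDiffOn_psiV (hB : ∀ v w, B v w = B w v) :
    ContDiffOn ℝ (⊤ : ℕ∞) CV.psiV CV.I :=
  (contDiffOn_const.mul (CV.contDiffOn_pairing CV.smooth_T CV.smooth_W₂)).congr
    fun _ hσ => CV.psiV_eq hB hσ

theorem contDiffOn_rhoV (hB : ∀ v w, B v w = B w v) (hε₁ : ε₁ * ε₁ = 1) :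
    ContDiffOn ℝ (⊤ : ℕ∞) CV.rhoV CV.I :=
  (contDiffOn_const.mul (CV.contDiffOn_varDeriv CV.smooth_η)).congr
    fun _ hσ => CV.rhoV_eq hB hε₁ hσ

theorem pairing_T_N (hB : ∀ v w, B v w = B w v) (ha : a ≠ 0) (hε₁ : ε₁ * ε₁ = 1)
    (hs : s ∈ CV.I) : B (varDeriv CV.T s) (CV.N s 0) = CV.alphaV s := by
  have hd : deriv (fun s => B (varDeriv CV.T s) (CV.W₁ s 0)) s = ε₁ * deriv CV.phiV s := by
    rw [Set.EqOn.deriv (fun σ hσ => CV.pairing_T_W₁ hB hε₁ hσ) CV.I_open hs,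
      deriv_const_mul_field]
  have h := CV.deriv_pairing CV.smooth_T CV.smooth_W₁ hs
  rw [hd, CV.deriv_varDeriv_T hs, CV.cartan_W₁ s hs 0 CV.J_zero, CV.η_one s hs] at h
  simp only [map_add, map_smul, LinearMap.add_apply, LinearMap.smul_apply, smul_eq_mul,
    CV.B_W₁W₁ s hs 0 CV.J_zero, CV.varDeriv_self_of_const hB CV.smooth_W₁ CV.B_W₁W₁ hs,
    CV.varDeriv_self_of_const hB CV.smooth_T CV.B_TT hs] at h
  rw [alphaV, CV.rhoV_eq hB hε₁ hs]
  field_simp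
  linear_combination (-ε₁) * h + (deriv CV.phiV s - a * varDeriv CV.η s
    - a * B (varDeriv CV.T s) (CV.N s 0)) * hε₁

theorem pairing_W₁_N (hB : ∀ v w, B v w = B w v) (ha : a ≠ 0) (hε₁ : ε₁ * ε₁ = 1)
    (hε₂ : ε₂ * ε₂ = 1) (hs : s ∈ CV.I) :
    B (varDeriv CV.W₁ s) (CV.N s 0) = CV.betaV s := by
  have hd : deriv (fun s => B (varDeriv CV.T s) (CV.N s 0)) s = deriv CV.alphaV s :=
    Set.EqOn.deriv (fun σ hσ => CV.pairing_T_N hB ha hε₁ hσ) CV.I_open hs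
  have h := CV.deriv_pairing CV.smooth_T CV.smooth_N hs
  rw [hd, CV.deriv_varDeriv_T hs, CV.cartan_N s hs 0 CV.J_zero, CV.η_one s hs] at h
  simp only [map_add, map_smul, LinearMap.add_apply, LinearMap.smul_apply, smul_eq_mul,
    CV.B_W₁N s hs 0 CV.J_zero, CV.pairing_T_W₁ hB hε₁ hs, CV.pairing_T_W₂ hB hε₂ hs] at h
  rw [betaV]
  field_simp
  linear_combination -h + CV.k₁ s 0 * CV.phiV s * hε₁ - CV.k₂ s 0 * CV.psiV s * hε₂

theorem pairing_W₁_W₂ (hB : ∀ v w, B v w = B w v) (ha : a ≠ 0) (hε₂ : ε₂ * ε₂ = 1)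
    (hs : s ∈ CV.I) :
    B (varDeriv CV.W₁ s) (CV.W₂ s 0) = ε₂ / a * deriv CV.psiV s := by
  have hd : deriv (fun s => B (varDeriv CV.T s) (CV.W₂ s 0)) s = ε₂ * deriv CV.psiV s := by
    rw [Set.EqOn.deriv (fun σ hσ => CV.pairing_T_W₂ hB hε₂ hσ) CV.I_open hs,
      deriv_const_mul_field]
  have h := CV.deriv_pairing CV.smooth_T CV.smooth_W₂ hs
  rw [hd, CV.deriv_varDeriv_T hs, CV.cartan_W₂ s hs 0 CV.J_zero, CV.η_one s hs] at h
  simp only [map_add, map_smul, LinearMap.add_apply, LinearMap.smul_apply, smul_eq_mul,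
    CV.B_W₁W₂ s hs 0 CV.J_zero, CV.varDeriv_self_of_const hB CV.smooth_T CV.B_TT hs] at h
  field_simp
  linear_combination -h

theorem pairing_W₂_N (hB : ∀ v w, B v w = B w v) (ha : a ≠ 0) (hε₁ : ε₁ * ε₁ = 1)
    (hε₂ : ε₂ * ε₂ = 1) (hs : s ∈ CV.I) :
    B (varDeriv CV.W₂ s) (CV.N s 0) = -(ε₁ * ε₂ / a) * CV.deltaV s := by
  have hd : deriv (fun s => B (varDeriv CV.W₁ s) (CV.W₂ s 0)) s =
      ε₂ / a * deriv (deriv CV.psiV) s := by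
    rw [Set.EqOn.deriv (fun σ hσ => CV.pairing_W₁_W₂ hB ha hε₂ hσ) CV.I_open hs,
      deriv_const_mul_field]
  have h := CV.deriv_pairing CV.smooth_W₁ CV.smooth_W₂ hs
  rw [hd, CV.deriv_varDeriv_W₁ hs, CV.cartan_W₂ s hs 0 CV.J_zero, CV.η_one s hs] at h
  have hWT := CV.varDeriv_pairing_of_const CV.smooth_W₁ CV.smooth_T CV.B_W₁T hs
  have hWN := CV.varDeriv_pairing_of_const CV.smooth_W₂ CV.smooth_N CV.B_W₂N hs
  rw [hB (CV.W₁ s 0), CV.pairing_T_W₁ hB hε₁ hs] at hWT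
  rw [hB (CV.W₂ s 0)] at hWN
  simp only [map_add, map_smul, LinearMap.add_apply, LinearMap.smul_apply, smul_eq_mul,
    hB (CV.T s 0), hB (CV.N s 0), CV.B_W₂T s hs 0 CV.J_zero, CV.B_W₂N s hs 0 CV.J_zero,
    CV.pairing_T_W₂ hB hε₂ hs, eq_neg_of_add_eq_zero_left hWT,
    eq_neg_of_add_eq_zero_right hWN] at h
  rw [deltaV]
  field_simp at h ⊢
  linear_combination ε₁ * h - a ^ 2 * B (varDeriv CV.W₂ s) (CV.N s 0) * hε₁
    + a * ε₁ ^ 2 * CV.k₂ s 0 * CV.phiV s * hε₂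

theorem varDeriv_k₁ (hB : ∀ v w, B v w = B w v) (ha : a ≠ 0) (hε₁ : ε₁ * ε₁ = 1)
    (hε₂ : ε₂ * ε₂ = 1) (hs : s ∈ CV.I) :
    varDeriv CV.k₁ s = deriv CV.betaV s - (1 / a) * CV.k₂ s 0 * deriv CV.psiV s
      + CV.k₁ s 0 * (CV.rhoV s / (2 * a) + CV.alphaV s) := by
  have hd : deriv (fun s => B (varDeriv CV.W₁ s) (CV.N s 0)) s = deriv CV.betaV s :=
    Set.EqOn.deriv (fun σ hσ => CV.pairing_W₁_N hB ha hε₁ hε₂ hσ) CV.I_open hs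
  have h := CV.deriv_pairing CV.smooth_W₁ CV.smooth_N hs
  rw [hd, CV.deriv_varDeriv_W₁ hs, CV.cartan_N s hs 0 CV.J_zero, CV.η_one s hs] at h
  simp only [map_add, map_smul, LinearMap.add_apply, LinearMap.smul_apply, smul_eq_mul,
    CV.B_TN s hs 0 CV.J_zero, CV.B_NN s hs 0 CV.J_zero,
    CV.varDeriv_self_of_const hB CV.smooth_W₁ CV.B_W₁W₁ hs,
    CV.varDeriv_self_of_const hB CV.smooth_N CV.B_NN hs,
    CV.pairing_T_N hB ha hε₁ hs, CV.pairing_W₁_W₂ hB ha hε₂ hs] at h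
  rw [h, CV.rhoV_eq hB hε₁ hs]
  field_simp
  linear_combination (-(CV.k₂ s 0 * deriv CV.psiV s)) * hε₂

theorem varDeriv_k₂ (hB : ∀ v w, B v w = B w v) (ha : a ≠ 0) (hε₁ : ε₁ * ε₁ = 1)
    (hε₂ : ε₂ * ε₂ = 1) (hs : s ∈ CV.I) :
    varDeriv CV.k₂ s = (ε₁ * ε₂ / a) * (deriv CV.deltaV s + CV.k₁ s 0 * deriv CV.psiV s)
      + CV.k₂ s 0 * (CV.rhoV s / (2 * a) + CV.alphaV s) := by
  have hd : deriv (fun s => B (varDeriv CV.W₂ s) (CV.N s 0)) s =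
      -(ε₁ * ε₂ / a) * deriv CV.deltaV s := by
    rw [Set.EqOn.deriv (fun σ hσ => CV.pairing_W₂_N hB ha hε₁ hε₂ hσ) CV.I_open hs,
      deriv_const_mul_field]
  have h := CV.deriv_pairing CV.smooth_W₂ CV.smooth_N hs
  rw [hd, CV.deriv_varDeriv_W₂ hs, CV.cartan_N s hs 0 CV.J_zero, CV.η_one s hs] at h
  have hW := CV.varDeriv_pairing_of_const CV.smooth_W₁ CV.smooth_W₂ CV.B_W₁W₂ hs
  rw [hB (CV.W₁ s 0), CV.pairing_W₁_W₂ hB ha hε₂ hs] at hW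
  simp only [map_add, map_smul, LinearMap.add_apply, LinearMap.smul_apply, smul_eq_mul,
    CV.B_TN s hs 0 CV.J_zero, eq_neg_of_add_eq_zero_right hW,
    CV.varDeriv_self_of_const hB CV.smooth_W₂ CV.B_W₂W₂ hs,
    CV.pairing_T_N hB ha hε₁ hs] at h
  rw [CV.rhoV_eq hB hε₁ hs]
  field_simp at h ⊢
  linear_combination h

theorem deriv_betaV (hB : ∀ v w, B v w = B w v) (hε₁ : ε₁ * ε₁ = 1) (hs : s ∈ CV.I) :
    deriv CV.betaV s =
      (1 / a) * ((1 / a) * (deriv (deriv (deriv CV.phiV)) s + deriv (deriv CV.rhoV) s / 2)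
        + deriv (fun s => CV.k₁ s 0 * CV.phiV s) s
        - deriv (fun s => CV.k₂ s 0 * CV.psiV s) s) := by
  have hφ := CV.contDiffOn_deriv (CV.contDiffOn_phiV hB)
  have hρ := CV.contDiffOn_rhoV hB hε₁
  have hα : Set.EqOn (deriv CV.alphaV)
      (fun s => (1 / a) * (deriv (deriv CV.phiV) s + deriv CV.rhoV s / 2)) CV.I := fun σ hσ =>
    (((CV.differentiableAt_of_contDiffOn hφ hσ).hasDerivAt.fun_add
      ((CV.differentiableAt_of_contDiffOn hρ hσ).hasDerivAt.div_const 2)).const_mul (1 / a)).deriv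
  have hα' := hα.deriv CV.I_open hs
  have hα'' := ((CV.differentiableAt_of_contDiffOn (CV.contDiffOn_deriv hφ) hs).hasDerivAt.fun_add
    ((CV.differentiableAt_of_contDiffOn (CV.contDiffOn_deriv hρ) hs).hasDerivAt.div_const
      2)).const_mul (1 / a)
  have hαd : DifferentiableAt ℝ (deriv CV.alphaV) s :=
    hα''.differentiableAt.congr_of_eventuallyEq (hα.eventuallyEq_of_mem (CV.I_open.mem_nhds hs))
  have hk₁ := CV.differentiableAt_of_contDiffOn
    ((CV.smooth_k₁.slice_fst CV.J_zero).mul (CV.contDiffOn_phiV hB)) hs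
  have hk₂ := CV.differentiableAt_of_contDiffOn
    ((CV.smooth_k₂.slice_fst CV.J_zero).mul (CV.contDiffOn_psiV hB)) hs
  rw [← hα''.deriv, ← hα']
  exact (((hαd.hasDerivAt.fun_add hk₁.hasDerivAt).fun_sub hk₂.hasDerivAt).const_mul (1 / a)).deriv

theorem deriv_deltaV (hB : ∀ v w, B v w = B w v) (hs : s ∈ CV.I) :
    deriv CV.deltaV s =
      (1 / a) * deriv (deriv (deriv CV.psiV)) s + deriv (fun s => CV.k₁ s 0 * CV.psiV s) s
        + ε₁ * ε₂ * deriv (fun s => CV.k₂ s 0 * CV.phiV s) s := by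
  have hψ := CV.differentiableAt_of_contDiffOn
    (CV.contDiffOn_deriv (CV.contDiffOn_deriv (CV.contDiffOn_psiV hB))) hs
  have hk₁ := CV.differentiableAt_of_contDiffOn
    ((CV.smooth_k₁.slice_fst CV.J_zero).mul (CV.contDiffOn_psiV hB)) hs
  have hk₂ := CV.differentiableAt_of_contDiffOn
    ((CV.smooth_k₂.slice_fst CV.J_zero).mul (CV.contDiffOn_phiV hB)) hs
  have h : CV.deltaV = fun s => (1 / a) * deriv (deriv CV.psiV) s + CV.k₁ s 0 * CV.psiV s
      + ε₁ * ε₂ * (CV.k₂ s 0 * CV.phiV s) := by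
    ext σ
    rw [deltaV, mul_assoc (ε₁ * ε₂)]
  rw [h]
  exact (((hψ.hasDerivAt.const_mul (1 / a)).fun_add hk₁.hasDerivAt).fun_add
    (hk₂.hasDerivAt.const_mul (ε₁ * ε₂))).deriv

end CartanVariation

open CartanVariation in
/-- The variation of the curvatures along `t = 0` (flat case `G = 0`). -/
theorem stmt4 (B : V4 →ₗ[ℝ] V4 →ₗ[ℝ] ℝ) (hB : ∀ v w, B v w = B w v)
    (a ε₁ ε₂ : ℝ) (ha : 0 < a) (hε₁ : ε₁ = 1 ∨ ε₁ = -1) (hε₂ : ε₂ = 1 ∨ ε₂ = -1)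
    (CV : CartanVariation B a ε₁ ε₂) :
    ∀ σ ∈ CV.I,
      deriv (fun u => CV.k₁ σ u) 0 =
          (1 / a ^ 2) * deriv (deriv (deriv CV.phiV)) σ
            + (1 / a) * (deriv (fun s => CV.k₁ s 0 * CV.phiV s) σ
                + CV.k₁ σ 0 * deriv CV.phiV σ)
            - (1 / a) * (deriv (fun s => CV.k₂ s 0 * CV.psiV s) σ
                + CV.k₂ σ 0 * deriv CV.psiV σ)
            + (1 / a) * ((1 / (2 * a)) * deriv (deriv CV.rhoV) σ
                + CV.k₁ σ 0 * CV.rhoV σ) ∧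
      deriv (fun u => CV.k₂ σ u) 0 =
          (ε₁ * ε₂ / a ^ 2) * deriv (deriv (deriv CV.psiV)) σ
            + (ε₁ * ε₂ / a) * (deriv (fun s => CV.k₁ s 0 * CV.psiV s) σ
                + CV.k₁ σ 0 * deriv CV.psiV σ)
            + (1 / a) * (deriv (fun s => CV.k₂ s 0 * CV.phiV s) σ
                + CV.k₂ σ 0 * deriv CV.phiV σ)
            + (1 / a) * CV.k₂ σ 0 * CV.rhoV σ := by
  intro σ hσ
  have ha' : a ≠ 0 := ha.ne'
  have h₁ : ε₁ * ε₁ = 1 := by rcases hε₁ with rfl | rfl <;> norm_num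
  have h₂ : ε₂ * ε₂ = 1 := by rcases hε₂ with rfl | rfl <;> norm_num
  constructor
  · refine (CV.varDeriv_k₁ hB ha' h₁ h₂ hσ).trans ?_
    rw [CV.deriv_betaV hB h₁ hσ, alphaV]
    field_simp
    ring
  · refine (CV.varDeriv_k₂ hB ha' h₁ h₂ hσ).trans ?_
    rw [CV.deriv_deltaV hB hσ, alphaV]
    field_simp
    linear_combination (2 * a * deriv (fun s => CV.k₂ s 0 * CV.phiV s) σ) *
      (ε₂ * ε₂ * h₁ + h₂)
end
end

section
/- Let (γ, T, W₁, N, W₂, k₁, k₂) be a Cartan framed null curve on I, let f, h, g, l : I → ℝ be smooth, and set V = f·T + h·W₁ + g·N + l·W₂ : I → ℝ⁴. Then the two conditions ⟨V′(σ), T(σ)⟩ = 0 and ⟨V″(σ), W₁(σ)⟩ = 0 hold for all σ ∈ I if and only if the two equations g′ = −ε₁·a·h and 2a·f′ + h″ − ε₁(k₁g)′ − a·k₁·h + a·k₂·l = 0 hold on I. -/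
noncomputable section

/-- A Cartan framed null curve in the flat pseudo-Euclidean `ℝ⁴` with symmetric bilinear
form `B`, constant `a` and signs `ε₁`, `ε₂`: smooth maps `γ, T, W₁, N, W₂ : I → ℝ⁴` and
smooth curvatures `k₁, k₂ : I → ℝ` with `γ′ = T`, the frame relations and the Cartan
equations holding on `I`. -/
structure CartanCurve (B : V4 →ₗ[ℝ] V4 →ₗ[ℝ] ℝ) (a ε₁ ε₂ : ℝ) where
  I : Set ℝ
  I_open : IsOpen I
  I_conn : I.OrdConnected
  I_ne : I.Nonempty
  γ : ℝ → V4
  T : ℝ → V4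
  W₁ : ℝ → V4
  N : ℝ → V4
  W₂ : ℝ → V4
  k₁ : ℝ → ℝ
  k₂ : ℝ → ℝ
  smooth_γ : ContDiffOn ℝ (⊤ : ℕ∞) γ I
  smooth_T : ContDiffOn ℝ (⊤ : ℕ∞) T I
  smooth_W₁ : ContDiffOn ℝ (⊤ : ℕ∞) W₁ I
  smooth_N : ContDiffOn ℝ (⊤ : ℕ∞) N I
  smooth_W₂ : ContDiffOn ℝ (⊤ : ℕ∞) W₂ I
  smooth_k₁ : ContDiffOn ℝ (⊤ : ℕ∞) k₁ I
  smooth_k₂ : ContDiffOn ℝ (⊤ : ℕ∞) k₂ I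
  γ_deriv : ∀ σ ∈ I, deriv γ σ = T σ
  B_TT : ∀ σ ∈ I, B (T σ) (T σ) = 0
  B_NN : ∀ σ ∈ I, B (N σ) (N σ) = 0
  B_TN : ∀ σ ∈ I, B (T σ) (N σ) = -1
  B_W₁T : ∀ σ ∈ I, B (W₁ σ) (T σ) = 0
  B_W₁N : ∀ σ ∈ I, B (W₁ σ) (N σ) = 0
  B_W₂T : ∀ σ ∈ I, B (W₂ σ) (T σ) = 0
  B_W₂N : ∀ σ ∈ I, B (W₂ σ) (N σ) = 0
  B_W₁W₂ : ∀ σ ∈ I, B (W₁ σ) (W₂ σ) = 0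
  B_W₁W₁ : ∀ σ ∈ I, B (W₁ σ) (W₁ σ) = ε₁
  B_W₂W₂ : ∀ σ ∈ I, B (W₂ σ) (W₂ σ) = ε₂
  cartan_T : ∀ σ ∈ I, deriv T σ = a • W₁ σ
  cartan_W₁ : ∀ σ ∈ I, deriv W₁ σ = (-(k₁ σ)) • T σ + (a * ε₁) • N σ
  cartan_N : ∀ σ ∈ I, deriv N σ = (-(ε₁ * k₁ σ)) • W₁ σ + (ε₂ * k₂ σ) • W₂ σ
  cartan_W₂ : ∀ σ ∈ I, deriv W₂ σ = k₂ σ • T σ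

namespace CartanCurve

variable {B : V4 →ₗ[ℝ] V4 →ₗ[ℝ] ℝ} {a ε₁ ε₂ : ℝ} (CC : CartanCurve B a ε₁ ε₂)

/-- The vector field `fT + hW₁ + gN + lW₂` along a Cartan framed null curve. -/
def frameField (f h g l : ℝ → ℝ) (σ : ℝ) : V4 :=
  f σ • CC.T σ + h σ • CC.W₁ σ + g σ • CC.N σ + l σ • CC.W₂ σ

variable {CC} {σ : ℝ}

theorem differentiableAt_of_contDiffOn {E : Type*} [NormedAddCommGroup E] [NormedSpace ℝ E]
    {F : ℝ → E} (hF : ContDiffOn ℝ (⊤ : ℕ∞) F CC.I) (hσ : σ ∈ CC.I) : DifferentiableAt ℝ F σ :=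
  (hF.contDiffAt (CC.I_open.mem_nhds hσ)).differentiableAt (by simp)

theorem contDiffOn_deriv {f : ℝ → ℝ} (hf : ContDiffOn ℝ (⊤ : ℕ∞) f CC.I) :
    ContDiffOn ℝ (⊤ : ℕ∞) (deriv f) CC.I :=
  hf.deriv_of_isOpen CC.I_open (by simp)

theorem deriv_frameField {f h g l : ℝ → ℝ} (hσ : σ ∈ CC.I)
    (hf : DifferentiableAt ℝ f σ) (hh : DifferentiableAt ℝ h σ)
    (hg : DifferentiableAt ℝ g σ) (hl : DifferentiableAt ℝ l σ) :
    deriv (CC.frameField f h g l) σ =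
      CC.frameField (fun s => deriv f s - CC.k₁ s * h s + CC.k₂ s * l s)
        (fun s => a * f s + deriv h s - ε₁ * (CC.k₁ s * g s))
        (fun s => deriv g s + ε₁ * a * h s)
        (fun s => deriv l s + ε₂ * (CC.k₂ s * g s)) σ := by
  have hT := (differentiableAt_of_contDiffOn CC.smooth_T hσ).hasDerivAt
  have hW₁ := (differentiableAt_of_contDiffOn CC.smooth_W₁ hσ).hasDerivAt
  have hN := (differentiableAt_of_contDiffOn CC.smooth_N hσ).hasDerivAt
  have hW₂ := (differentiableAt_of_contDiffOn CC.smooth_W₂ hσ).hasDerivAt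
  rw [CC.cartan_T σ hσ] at hT
  rw [CC.cartan_W₁ σ hσ] at hW₁
  rw [CC.cartan_N σ hσ] at hN
  rw [CC.cartan_W₂ σ hσ] at hW₂
  refine ((((hf.hasDerivAt.smul hT).add (hh.hasDerivAt.smul hW₁)).add
    (hg.hasDerivAt.smul hN)).add (hl.hasDerivAt.smul hW₂)).deriv.trans ?_
  simp only [frameField]
  module

theorem apply_frameField_T (hB : ∀ v w, B v w = B w v) (f h g l : ℝ → ℝ) (hσ : σ ∈ CC.I) :
    B (CC.frameField f h g l σ) (CC.T σ) = -g σ := by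
  simp [frameField, CC.B_TT σ hσ, CC.B_W₁T σ hσ, hB (CC.N σ), CC.B_TN σ hσ, CC.B_W₂T σ hσ]

theorem apply_frameField_W₁ (hB : ∀ v w, B v w = B w v) (f h g l : ℝ → ℝ) (hσ : σ ∈ CC.I) :
    B (CC.frameField f h g l σ) (CC.W₁ σ) = ε₁ * h σ := by
  simp [frameField, hB _ (CC.W₁ σ), CC.B_W₁T σ hσ, CC.B_W₁W₁ σ hσ, CC.B_W₁N σ hσ,
    CC.B_W₁W₂ σ hσ, mul_comm]

theorem apply_deriv_frameField_T (hB : ∀ v w, B v w = B w v) {f h g l : ℝ → ℝ}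
    (hf : ContDiffOn ℝ (⊤ : ℕ∞) f CC.I) (hh : ContDiffOn ℝ (⊤ : ℕ∞) h CC.I)
    (hg : ContDiffOn ℝ (⊤ : ℕ∞) g CC.I) (hl : ContDiffOn ℝ (⊤ : ℕ∞) l CC.I)
    (hσ : σ ∈ CC.I) :
    B (deriv (CC.frameField f h g l) σ) (CC.T σ) = -(deriv g σ + ε₁ * a * h σ) := by
  rw [deriv_frameField hσ (differentiableAt_of_contDiffOn hf hσ)
    (differentiableAt_of_contDiffOn hh hσ) (differentiableAt_of_contDiffOn hg hσ)
    (differentiableAt_of_contDiffOn hl hσ), apply_frameField_T hB _ _ _ _ hσ]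

theorem apply_deriv_deriv_frameField_W₁ (hB : ∀ v w, B v w = B w v) {f h g l : ℝ → ℝ}
    (hf : ContDiffOn ℝ (⊤ : ℕ∞) f CC.I) (hh : ContDiffOn ℝ (⊤ : ℕ∞) h CC.I)
    (hg : ContDiffOn ℝ (⊤ : ℕ∞) g CC.I) (hl : ContDiffOn ℝ (⊤ : ℕ∞) l CC.I)
    (hσ : σ ∈ CC.I) :
    B (deriv (deriv (CC.frameField f h g l)) σ) (CC.W₁ σ) =
      ε₁ * (2 * a * deriv f σ + deriv (deriv h) σ - ε₁ * deriv (fun s => CC.k₁ s * g s) σ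
        - a * CC.k₁ σ * h σ + a * CC.k₂ σ * l σ
        - ε₁ * CC.k₁ σ * (deriv g σ + ε₁ * a * h σ)) := by
  have hV := Filter.eventuallyEq_of_mem (CC.I_open.mem_nhds hσ) fun s hs =>
    deriv_frameField (CC := CC) hs (differentiableAt_of_contDiffOn hf hs)
      (differentiableAt_of_contDiffOn hh hs) (differentiableAt_of_contDiffOn hg hs)
      (differentiableAt_of_contDiffOn hl hs)
  have df := differentiableAt_of_contDiffOn hf hσ
  have dh := differentiableAt_of_contDiffOn hh hσ
  have dg := differentiableAt_of_contDiffOn hg hσ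
  have dl := differentiableAt_of_contDiffOn hl hσ
  have df' := differentiableAt_of_contDiffOn (contDiffOn_deriv hf) hσ
  have dh' := differentiableAt_of_contDiffOn (contDiffOn_deriv hh) hσ
  have dg' := differentiableAt_of_contDiffOn (contDiffOn_deriv hg) hσ
  have dl' := differentiableAt_of_contDiffOn (contDiffOn_deriv hl) hσ
  have dk₁ := differentiableAt_of_contDiffOn CC.smooth_k₁ hσ
  have dk₂ := differentiableAt_of_contDiffOn CC.smooth_k₂ hσ
  have hW₁ : deriv (fun s => a * f s + deriv h s - ε₁ * (CC.k₁ s * g s)) σ =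
      a * deriv f σ + deriv (deriv h) σ - ε₁ * deriv (fun s => CC.k₁ s * g s) σ :=
    (((df.hasDerivAt.const_mul a).add dh'.hasDerivAt).sub
      ((dk₁.mul dg).hasDerivAt.const_mul ε₁)).deriv
  rw [hV.deriv_eq, deriv_frameField hσ (by fun_prop) (by fun_prop) (by fun_prop) (by fun_prop),
    apply_frameField_W₁ hB _ _ _ _ hσ, hW₁]
  ring

end CartanCurve

/-- A vector field `V = fT + hW₁ + gN + lW₂` along a Cartan framed null
curve locally preserves the causal character and the pseudo arc-length parameter
(`⟨V′,T⟩ = 0` and `⟨V″,W₁⟩ = 0`) iff `g′ = −ε₁ a h` and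
`2a f′ + h″ − ε₁(k₁g)′ − a k₁ h + a k₂ l = 0` on `I`. -/
theorem stmt5 (B : V4 →ₗ[ℝ] V4 →ₗ[ℝ] ℝ) (hB : ∀ v w, B v w = B w v)
    (a ε₁ ε₂ : ℝ) (ha : 0 < a) (hε₁ : ε₁ = 1 ∨ ε₁ = -1) (hε₂ : ε₂ = 1 ∨ ε₂ = -1)
    (CC : CartanCurve B a ε₁ ε₂) (f h g l : ℝ → ℝ)
    (hf : ContDiffOn ℝ (⊤ : ℕ∞) f CC.I) (hh : ContDiffOn ℝ (⊤ : ℕ∞) h CC.I)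
    (hg : ContDiffOn ℝ (⊤ : ℕ∞) g CC.I) (hl : ContDiffOn ℝ (⊤ : ℕ∞) l CC.I)
    (V : ℝ → V4)
    (hV : V = fun σ => f σ • CC.T σ + h σ • CC.W₁ σ + g σ • CC.N σ + l σ • CC.W₂ σ) :
    ((∀ σ ∈ CC.I, B (deriv V σ) (CC.T σ) = 0) ∧
      (∀ σ ∈ CC.I, B (deriv (deriv V) σ) (CC.W₁ σ) = 0)) ↔
    ((∀ σ ∈ CC.I, deriv g σ = -(ε₁ * a) * h σ) ∧
      (∀ σ ∈ CC.I,
        2 * a * deriv f σ + deriv (deriv h) σ - ε₁ * deriv (fun s => CC.k₁ s * g s) σ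
          - a * CC.k₁ σ * h σ + a * CC.k₂ σ * l σ = 0)) := by
  obtain rfl : V = CC.frameField f h g l := hV
  have hε₁0 : ε₁ ≠ 0 := by rcases hε₁ with rfl | rfl <;> norm_num
  have tangential : (∀ σ ∈ CC.I, B (deriv (CC.frameField f h g l) σ) (CC.T σ) = 0) ↔
      ∀ σ ∈ CC.I, deriv g σ = -(ε₁ * a) * h σ := by
    refine forall₂_congr fun σ hσ => ?_
    rw [CartanCurve.apply_deriv_frameField_T hB hf hh hg hl hσ, neg_eq_zero,
      add_eq_zero_iff_eq_neg, neg_mul]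
  rw [tangential]
  refine and_congr_right fun hg' => forall₂_congr fun σ hσ => ?_
  rw [CartanCurve.apply_deriv_deriv_frameField_W₁ hB hf hh hg hl hσ, mul_eq_zero,
    or_iff_right hε₁0, hg' σ hσ, neg_mul, neg_add_cancel, mul_zero, sub_zero]
end
end

section
/- Let (γ, T, W₁, N, W₂, k₁, k₂) be a Cartan framed null curve on I, let f, h, g, l : I → ℝ be smooth functions satisfying g′ = −ε₁·a·h and 2a·f′ + h″ − ε₁(k₁g)′ − a·k₁·h + a·k₂·l = 0 on I, and set V = f·T + h·W₁ + g·N + l·W₂, φ_V = a·f + h′ − ε₁k₁g and ψ_V = l′ + ε₂k₂g. Then V′ = −(1/a)·φ_V′·T + φ_V·W₁ + ψ_V·W₂ on I; in particular ⟨V′, T⟩ = 0, ε₁⟨V′, W₁⟩ = φ_V and ε₂⟨V′, W₂⟩ = ψ_V. -/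
noncomputable section

/-- If `V = fT + hW₁ + gN + lW₂` satisfies `g′ = −ε₁ a h` and
`2a f′ + h″ − ε₁(k₁g)′ − a k₁ h + a k₂ l = 0`, then
`V′ = −(1/a)φ_V′ T + φ_V W₁ + ψ_V W₂` where `φ_V = a f + h′ − ε₁k₁g` and
`ψ_V = l′ + ε₂k₂g`; in particular `⟨V′,T⟩ = 0`, `ε₁⟨V′,W₁⟩ = φ_V`, `ε₂⟨V′,W₂⟩ = ψ_V`. -/
theorem stmt6 (B : V4 →ₗ[ℝ] V4 →ₗ[ℝ] ℝ) (hB : ∀ v w, B v w = B w v)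
    (a ε₁ ε₂ : ℝ) (ha : 0 < a) (hε₁ : ε₁ = 1 ∨ ε₁ = -1) (hε₂ : ε₂ = 1 ∨ ε₂ = -1)
    (CC : CartanCurve B a ε₁ ε₂) (f h g l : ℝ → ℝ)
    (hf : ContDiffOn ℝ (⊤ : ℕ∞) f CC.I) (hh : ContDiffOn ℝ (⊤ : ℕ∞) h CC.I)
    (hg : ContDiffOn ℝ (⊤ : ℕ∞) g CC.I) (hl : ContDiffOn ℝ (⊤ : ℕ∞) l CC.I)
    (h1 : ∀ σ ∈ CC.I, deriv g σ = -(ε₁ * a) * h σ)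
    (h2 : ∀ σ ∈ CC.I,
      2 * a * deriv f σ + deriv (deriv h) σ - ε₁ * deriv (fun s => CC.k₁ s * g s) σ
        - a * CC.k₁ σ * h σ + a * CC.k₂ σ * l σ = 0)
    (V : ℝ → V4)
    (hV : V = fun σ => f σ • CC.T σ + h σ • CC.W₁ σ + g σ • CC.N σ + l σ • CC.W₂ σ)
    (φ ψ : ℝ → ℝ)
    (hφ : φ = fun σ => a * f σ + deriv h σ - ε₁ * CC.k₁ σ * g σ)
    (hψ : ψ = fun σ => deriv l σ + ε₂ * CC.k₂ σ * g σ) :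
    ∀ σ ∈ CC.I,
      deriv V σ = (-(1 / a) * deriv φ σ) • CC.T σ + φ σ • CC.W₁ σ + ψ σ • CC.W₂ σ ∧
      B (deriv V σ) (CC.T σ) = 0 ∧
      ε₁ * B (deriv V σ) (CC.W₁ σ) = φ σ ∧
      ε₂ * B (deriv V σ) (CC.W₂ σ) = ψ σ := by
  intro σ hσ
  have hI : CC.I ∈ nhds σ := CC.I_open.mem_nhds hσ
  have differentiableAt {E : Type} [NormedAddCommGroup E] [NormedSpace ℝ E] {u : ℝ → E}
      (hu : ContDiffOn ℝ (⊤ : ℕ∞) u CC.I) : DifferentiableAt ℝ u σ :=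
    (hu.contDiffAt hI).differentiableAt (by simp)
  have hf' := (differentiableAt hf).hasDerivAt
  have hh' := (differentiableAt hh).hasDerivAt
  have hg' := (differentiableAt hg).hasDerivAt
  have hl' := (differentiableAt hl).hasDerivAt
  have hk' := (differentiableAt CC.smooth_k₁).hasDerivAt
  have hT := (differentiableAt CC.smooth_T).hasDerivAt
  have hW₁ := (differentiableAt CC.smooth_W₁).hasDerivAt
  have hN := (differentiableAt CC.smooth_N).hasDerivAt
  have hW₂ := (differentiableAt CC.smooth_W₂).hasDerivAt
  have hh'' : HasDerivAt (deriv h) (deriv (deriv h) σ) σ :=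
    (differentiableAt (hh.deriv_of_isOpen CC.I_open (m := (⊤ : ℕ∞)) (by simp))).hasDerivAt
  rw [CC.cartan_T σ hσ] at hT
  rw [CC.cartan_W₁ σ hσ] at hW₁
  rw [CC.cartan_N σ hσ] at hN
  rw [CC.cartan_W₂ σ hσ] at hW₂
  have hkg : deriv (fun s => CC.k₁ s * g s) σ = _ := (hk'.mul hg').deriv
  have dφ : deriv φ σ = a * deriv f σ + deriv (deriv h) σ
      - ε₁ * deriv (fun s => CC.k₁ s * g s) σ := by
    have hφ' : φ = fun s => a * f s + deriv h s - ε₁ * (CC.k₁ s * g s) := by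
      rw [hφ]; funext s; ring
    rw [hφ', hkg]
    exact (((hf'.const_mul a).add hh'').sub ((hk'.mul hg').const_mul ε₁)).deriv
  have hTcoef : -(1 / a) * deriv φ σ
      = deriv f σ - h σ * CC.k₁ σ + l σ * CC.k₂ σ := by
    have ha' : a ≠ 0 := ha.ne'
    rw [dφ]
    field_simp
    linear_combination -(h2 σ hσ)
  have dV : deriv V σ
      = (-(1 / a) * deriv φ σ) • CC.T σ + φ σ • CC.W₁ σ + ψ σ • CC.W₂ σ := by
    have hd := (((hf'.smul hT).add (hh'.smul hW₁)).add (hg'.smul hN)).add (hl'.smul hW₂)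
    rw [hTcoef, hV, hφ, hψ]
    refine hd.deriv.trans ?_
    rw [h1 σ hσ]
    module
  have hε₁' : ε₁ * ε₁ = 1 := by rcases hε₁ with rfl | rfl <;> norm_num
  have hε₂' : ε₂ * ε₂ = 1 := by rcases hε₂ with rfl | rfl <;> norm_num
  have hTW₁ : B (CC.T σ) (CC.W₁ σ) = 0 := (hB _ _).trans (CC.B_W₁T σ hσ)
  have hTW₂ : B (CC.T σ) (CC.W₂ σ) = 0 := (hB _ _).trans (CC.B_W₂T σ hσ)
  have hW₂W₁ : B (CC.W₂ σ) (CC.W₁ σ) = 0 := (hB _ _).trans (CC.B_W₁W₂ σ hσ)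
  refine ⟨dV, ?_, ?_, ?_⟩ <;> rw [dV] <;>
    simp only [map_add, map_smul, LinearMap.add_apply, LinearMap.smul_apply, smul_eq_mul,
      CC.B_TT σ hσ, CC.B_W₁T σ hσ, CC.B_W₂T σ hσ, CC.B_W₁W₁ σ hσ, CC.B_W₁W₂ σ hσ,
      CC.B_W₂W₂ σ hσ, hTW₁, hTW₂, hW₂W₁]
  · ring
  · linear_combination φ σ * hε₁'
  · linear_combination ψ σ * hε₂'
end
end

section
/- Let V = (f, h, g, l) ∈ 𝒫⁴. Then the following are equivalent: (i) g′ = −ε₁·a·h and ρ_V = 0; (ii) there exist real constants c₁, c₂ and elements p, q ∈ 𝒫 with p′ = h and q′ = k₁h − k₂l such that g = −ε₁·a·p + c₁ and f = −(1/(2a))·(h′ + a·k₁·p − a·q − ε₁c₁k₁) + c₂. -/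
noncomputable section
open MvPolynomial

/-- The differential algebra `𝒫`: polynomials in `k₁⁽ᵐ⁾ = X (0, m)` and `k₂⁽ᵐ⁾ = X (1, m)`. -/
abbrev PP : Type := MvPolynomial (Fin 2 × ℕ) ℝ

/-- The derivation `f ↦ f′` with `D (kᵢ⁽ᵐ⁾) = kᵢ⁽ᵐ⁺¹⁾`. -/
def Dx : Derivation ℝ PP PP :=
  MvPolynomial.mkDerivation ℝ (fun im : Fin 2 × ℕ => MvPolynomial.X (im.1, im.2 + 1))

def k1 : PP := MvPolynomial.X (0, 0)
def k2 : PP := MvPolynomial.X (1, 0)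

/-- A `𝒫`-local vector field: a quadruple `(f, h, g, l) ∈ 𝒫⁴`. -/
structure LVF where
  f : PP
  h : PP
  g : PP
  l : PP

namespace LVF

instance : Zero LVF := ⟨⟨0, 0, 0, 0⟩⟩
instance : Neg LVF := ⟨fun U => ⟨-U.f, -U.h, -U.g, -U.l⟩⟩
instance : Add LVF := ⟨fun U W => ⟨U.f + W.f, U.h + W.h, U.g + W.g, U.l + W.l⟩⟩
instance : Sub LVF := ⟨fun U W => ⟨U.f - W.f, U.h - W.h, U.g - W.g, U.l - W.l⟩⟩

def phi (a ε₁ : ℝ) (V : LVF) : PP := C a * V.f + Dx V.h - C ε₁ * k1 * V.g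

def psi (ε₂ : ℝ) (V : LVF) : PP := Dx V.l + C ε₂ * k2 * V.g

def rho (a ε₁ : ℝ) (V : LVF) : PP :=
  - C a * Dx V.f + C (2 * a) * k1 * V.h - C a * k2 * V.l
    - Dx (phi a ε₁ V) + C ε₁ * k1 * Dx V.g

/-- Membership in `𝔛*`: `g_V′ = −ε₁·a·h_V`. -/
def isStar (a ε₁ : ℝ) (V : LVF) : Prop := Dx V.g = - C (ε₁ * a) * V.h

def alpha (a ε₁ : ℝ) (V : LVF) : PP :=
  C (1 / a) * (Dx (phi a ε₁ V) + C (1 / 2) * rho a ε₁ V)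

def beta (a ε₁ ε₂ G : ℝ) (V : LVF) : PP :=
  C (1 / a) * (Dx (alpha a ε₁ V) + k1 * phi a ε₁ V - k2 * psi ε₂ V - C G * V.g)

def delta (a ε₁ ε₂ : ℝ) (V : LVF) : PP :=
  C (1 / a) * Dx (Dx (psi ε₂ V)) + k1 * psi ε₂ V + C (ε₁ * ε₂) * k2 * phi a ε₁ V

/-- The value `V̂(k₁)`. -/
def vk1 (a ε₁ ε₂ G : ℝ) (V : LVF) : PP :=
  C (1 / a ^ 2) * Dx (Dx (Dx (phi a ε₁ V)))
    + C (1 / a) * (Dx (k1 * phi a ε₁ V) + k1 * Dx (phi a ε₁ V))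
    - C (1 / a) * (Dx (k2 * psi ε₂ V) + k2 * Dx (psi ε₂ V))
    + C (1 / a) * (C (1 / (2 * a)) * Dx (Dx (rho a ε₁ V)) + k1 * rho a ε₁ V
        - C (2 * G) * Dx V.g)

/-- The value `V̂(k₂)`. -/
def vk2 (a ε₁ ε₂ G : ℝ) (V : LVF) : PP :=
  C (ε₁ * ε₂ / a ^ 2) * Dx (Dx (Dx (psi ε₂ V)))
    + C (ε₁ * ε₂ / a) * (Dx (k1 * psi ε₂ V) + k1 * Dx (psi ε₂ V))
    + C (1 / a) * (Dx (k2 * phi a ε₁ V) + k2 * Dx (phi a ε₁ V))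
    + C (1 / a) * (k2 * rho a ε₁ V) - C (ε₂ * G) * V.l

/-- Values of `V̂` on the generators, defined by the recursion
`V̂(kᵢ⁽ᵐ⁺¹⁾) = (V̂(kᵢ⁽ᵐ⁾))′ + (1/(2a))·ρ_V·kᵢ⁽ᵐ⁺¹⁾`. -/
def vhatFun (a ε₁ ε₂ G : ℝ) (V : LVF) : Fin 2 × ℕ → PP := fun im =>
  Nat.rec (motive := fun _ => PP)
    (if im.1 = 0 then vk1 a ε₁ ε₂ G V else vk2 a ε₁ ε₂ G V)
    (fun m prev => Dx prev + C (1 / (2 * a)) * rho a ε₁ V * MvPolynomial.X (im.1, m + 1))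
    im.2

/-- The derivation `V̂` attached to `V ∈ 𝔛*`. -/
def vhat (a ε₁ ε₂ G : ℝ) (V : LVF) : Derivation ℝ PP PP :=
  MvPolynomial.mkDerivation ℝ (vhatFun a ε₁ ε₂ G V)

/-- The operator `D_V U`. -/
def DV (a ε₁ ε₂ G : ℝ) (V U : LVF) : LVF where
  f := vhat a ε₁ ε₂ G V U.f - alpha a ε₁ V * U.f - beta a ε₁ ε₂ G V * U.h
        + C (ε₁ * ε₂ / a) * delta a ε₁ ε₂ V * U.l
  h := vhat a ε₁ ε₂ G V U.h + phi a ε₁ V * U.f - C ε₁ * beta a ε₁ ε₂ G V * U.g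
        - C (ε₁ * ε₂ / a) * Dx (psi ε₂ V) * U.l
  g := vhat a ε₁ ε₂ G V U.g + C ε₁ * phi a ε₁ V * U.h + alpha a ε₁ V * U.g
        + C ε₂ * psi ε₂ V * U.l
  l := vhat a ε₁ ε₂ G V U.l + psi ε₂ V * U.f + C (1 / a) * Dx (psi ε₂ V) * U.h
        + C (ε₁ / a) * delta a ε₁ ε₂ V * U.g

/-- The bracket `[V₁, V₂] = D_{V₁}V₂ − D_{V₂}V₁`. -/
def bracket (a ε₁ ε₂ G : ℝ) (V₁ V₂ : LVF) : LVF :=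
  DV a ε₁ ε₂ G V₁ V₂ - DV a ε₁ ε₂ G V₂ V₁

end LVF

/-- The derivation `Dx` kills constants. -/
theorem Dx_C (r : ℝ) : Dx (MvPolynomial.C r) = 0 :=
  MvPolynomial.derivation_C Dx r

/-- Characterization of the pseudo arc-length preserving `𝒫`-local
vector fields by two constants of integration. -/
theorem stmt7 (a ε₁ ε₂ G : ℝ) (ha : a ≠ 0) (hε₁ : ε₁ = 1 ∨ ε₁ = -1)
    (hε₂ : ε₂ = 1 ∨ ε₂ = -1) (V : LVF) :
    (LVF.isStar a ε₁ V ∧ LVF.rho a ε₁ V = 0) ↔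
      ∃ (c₁ c₂ : ℝ) (p q : PP), Dx p = V.h ∧ Dx q = k1 * V.h - k2 * V.l ∧
        V.g = - MvPolynomial.C (ε₁ * a) * p + MvPolynomial.C c₁ ∧
        V.f = - MvPolynomial.C (1 / (2 * a)) *
            (Dx V.h + MvPolynomial.C a * k1 * p - MvPolynomial.C a * q
              - MvPolynomial.C (ε₁ * c₁) * k1) + MvPolynomial.C c₂ := by
  have hE : (C ε₁ : PP) * C ε₁ = 1 := by
    rw [← C_mul, ← C_1]
    rcases hε₁ with rfl | rfl <;> norm_num
  have hB : 2 * C a * C (1 / (2 * a)) = (1 : PP) := by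
    rw [← map_ofNat (C : ℝ →+* PP) 2, ← C_mul, ← C_mul, ← C_1]
    congr 1
    field_simp
  have h2a : (C (2 * a) : PP) = 2 * C a := by rw [C_mul, map_ofNat]
  obtain ⟨f, h, g, l⟩ := V
  simp only [LVF.isStar, LVF.rho, LVF.phi, h2a, C_mul (a := ε₁)]
  have hDB := Dx_C (1 / (2 * a))
  have hD2 : Dx 2 = 0 := by rw [← map_ofNat (C : ℝ →+* PP) 2, Dx_C]
  generalize C (1 / (2 * a)) = B at hB hDB ⊢
  constructor
  · rintro ⟨hg, hρ⟩
    simp only [map_add, map_sub, Derivation.leibniz, smul_eq_mul, Dx_C] at hρ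
    refine ⟨0, 0, -(2 * B * C ε₁ * g), 2 * f + 2 * B * Dx h - 2 * B * C ε₁ * k1 * g,
      ?_, ?_, ?_, ?_⟩ <;>
    simp only [map_add, map_sub, map_neg, Derivation.leibniz, smul_eq_mul, Dx_C, hDB, hD2,
      map_zero, mul_zero]
    · linear_combination (-2 * B * C ε₁) * hg + h * C ε₁ ^ 2 * hB + h * hE
    · linear_combination (-2 * B) * hρ + 2 * B * C ε₁ * k1 * hg
        + (-2 * Dx f + k1 * h - k2 * l) * hB - 2 * C a * B * k1 * h * hE
    · linear_combination (-g * C ε₁ ^ 2) * hB - g * hE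
    · linear_combination (-f - B * Dx h) * hB
  · rintro ⟨c₁, c₂, p, q, hp, hq, rfl, rfl⟩
    simp only [map_add, map_sub, map_neg, Derivation.leibniz, smul_eq_mul, Dx_C, hDB,
      hp, hq]
    constructor
    · ring
    · linear_combination (Dx (Dx h) + C a * Dx k1 * p + C a * k2 * l - C ε₁ * C c₁ * Dx k1) * hB
        - (C a * Dx k1 * p + 2 * C a * k1 * h) * hE
end
end

section
/- For all V₁, V₂ ∈ 𝔛*, the bracket [V₁, V₂] = D_{V₁}V₂ − D_{V₂}V₁ again belongs to 𝔛*, i.e. its components satisfy g_{[V₁,V₂]}′ = −ε₁·a·h_{[V₁,V₂]}. -/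
noncomputable section
open MvPolynomial

namespace LVF

/-- The commutator of `V̂` with the total derivative is `(1/(2a))·ρ_V` times the total
derivative. -/
theorem vhat_Dx (a ε₁ ε₂ G : ℝ) (V : LVF) (p : PP) :
    vhat a ε₁ ε₂ G V (Dx p)
      = Dx (vhat a ε₁ ε₂ G V p) + C (1 / (2 * a)) * rho a ε₁ V * Dx p := by
  have h : ⁅vhat a ε₁ ε₂ G V, Dx⁆ = (C (1 / (2 * a)) * rho a ε₁ V) • Dx := by
    refine MvPolynomial.derivation_ext fun i => ?_
    rw [Derivation.commutator_apply, Derivation.smul_apply, smul_eq_mul]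
    simp only [Dx, vhat, mkDerivation_X]
    exact sub_eq_of_eq_add' rfl
  have hp := congrArg (fun d : Derivation ℝ PP PP => d p) h
  simp only [Derivation.commutator_apply, Derivation.smul_apply, smul_eq_mul] at hp
  linear_combination hp

/-- A derivation of `𝒫` commutes with multiplication by constants. -/
theorem derivation_C_mul (d : Derivation ℝ PP PP) (r : ℝ) (p : PP) :
    d (C r * p) = C r * d p := by
  rw [← smul_eq_C_mul, ← smul_eq_C_mul, Derivation.map_smul]

/-- The defect of `D_V U` from satisfying the defining equation of `𝔛*` is symmetric in
`V` and `U`. -/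
theorem Dx_DV_g_add (a ε₁ ε₂ G : ℝ) (ha : a ≠ 0) (hε₁ : ε₁ * ε₁ = 1) (hε₂ : ε₂ * ε₂ = 1)
    (V U : LVF) (hU : isStar a ε₁ U) :
    Dx (DV a ε₁ ε₂ G V U).g + C (ε₁ * a) * (DV a ε₁ ε₂ G V U).h
      = C ε₁ * phi a ε₁ V * phi a ε₁ U + C ε₂ * psi ε₂ V * psi ε₂ U + C G * V.g * U.g := by
  have hinv : (C a * C (1 / a) : PP) = 1 := by rw [← C_mul, mul_one_div_cancel ha, C_1]
  have hhalf : (C a * C (1 / (2 * a)) : PP) = C (1 / 2) := by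
    rw [← C_mul]; congr 1; field_simp
  have hc : (C a * C (ε₁ * ε₂ / a) : PP) = C ε₁ * C ε₂ := by
    rw [← C_mul, ← C_mul]; congr 1; field_simp
  have he₁ : (C ε₁ * C ε₁ : PP) = 1 := by rw [← C_mul, hε₁, C_1]
  have he₂ : (C ε₂ * C ε₂ : PP) = 1 := by rw [← C_mul, hε₂, C_1]
  have hα : C a * alpha a ε₁ V = Dx (phi a ε₁ V) + C (1 / 2) * rho a ε₁ V := by
    rw [alpha, ← mul_assoc, hinv, one_mul]
  have hβ : C a * beta a ε₁ ε₂ G V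
      = Dx (alpha a ε₁ V) + k1 * phi a ε₁ V - k2 * psi ε₂ V - C G * V.g := by
    rw [beta, ← mul_assoc, hinv, one_mul]
  have hφ : phi a ε₁ U = C a * U.f + Dx U.h - C ε₁ * k1 * U.g := rfl
  have hψ : psi ε₂ U = Dx U.l + C ε₂ * k2 * U.g := rfl
  have hU' : Dx U.g = -(C ε₁ * C a * U.h) := by rw [hU, C_mul, neg_mul]
  have hV : Dx (vhat a ε₁ ε₂ G V U.g) = -(C ε₁ * C a * vhat a ε₁ ε₂ G V U.h)
      + C ε₁ * C (1 / 2) * rho a ε₁ V * U.h := by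
    have h := vhat_Dx a ε₁ ε₂ G V U.g
    rw [hU', mul_assoc, map_neg, derivation_C_mul, derivation_C_mul] at h
    linear_combination -h + C ε₁ * rho a ε₁ V * U.h * hhalf
  simp only [DV, map_add, Derivation.leibniz, derivation_C, smul_eq_mul, C_mul]
  rw [hV, hU', hφ, hψ]
  linear_combination -C ε₁ * U.h * hα - U.g * hβ
    - C a * beta a ε₁ ε₂ G V * U.g * he₁
    - C ε₁ * Dx (psi ε₂ V) * U.l * hc
    - C ε₂ * Dx (psi ε₂ V) * U.l * he₁
    + k1 * phi a ε₁ V * U.g * he₁ - k2 * psi ε₂ V * U.g * he₂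

end LVF

/-- The bracket of two elements of `𝔛*` again belongs to `𝔛*`. -/
theorem stmt8 (a ε₁ ε₂ G : ℝ) (ha : a ≠ 0) (hε₁ : ε₁ = 1 ∨ ε₁ = -1)
    (hε₂ : ε₂ = 1 ∨ ε₂ = -1) (V₁ V₂ : LVF)
    (h₁ : LVF.isStar a ε₁ V₁) (h₂ : LVF.isStar a ε₁ V₂) :
    LVF.isStar a ε₁ (LVF.bracket a ε₁ ε₂ G V₁ V₂) := by
  have e₁ : ε₁ * ε₁ = 1 := mul_self_eq_one_iff.mpr hε₁
  have e₂ : ε₂ * ε₂ = 1 := mul_self_eq_one_iff.mpr hε₂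
  have h₁₂ := LVF.Dx_DV_g_add a ε₁ ε₂ G ha e₁ e₂ V₁ V₂ h₂
  have h₂₁ := LVF.Dx_DV_g_add a ε₁ ε₂ G ha e₁ e₂ V₂ V₁ h₁
  change Dx ((LVF.DV a ε₁ ε₂ G V₁ V₂).g - (LVF.DV a ε₁ ε₂ G V₂ V₁).g)
    = -C (ε₁ * a) * ((LVF.DV a ε₁ ε₂ G V₁ V₂).h - (LVF.DV a ε₁ ε₂ G V₂ V₁).h)
  rw [map_sub]
  linear_combination h₁₂ - h₂₁
end
end

section
/- For all V₁, V₂ ∈ 𝔛*, the derivation attached to the bracket equals the commutator of the attached derivations: writing V₁₂ = [V₁, V₂] ∈ 𝔛*, one has V̂₁₂ = V̂₁ ∘ V̂₂ − V̂₂ ∘ V̂₁ as ℝ-linear derivations of 𝒫; equivalently, V̂₁₂(f) = V̂₁(V̂₂(f)) − V̂₂(V̂₁(f)) for every f ∈ 𝒫. -/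
noncomputable section
open MvPolynomial

namespace LVF

/-- The rescaled tangential speed `ρ_V / (2a)`. -/
def speed (a ε₁ : ℝ) (V : LVF) : PP := C (1 / (2 * a)) * rho a ε₁ V

/-- The frame coefficient `ψ_V′ / a`. -/
def sigma (a ε₂ : ℝ) (V : LVF) : PP := C (1 / a) * Dx (psi ε₂ V)

/-- The frame coefficient `δ_V / a`. -/
def tau (a ε₁ ε₂ : ℝ) (V : LVF) : PP := C (1 / a) * delta a ε₁ ε₂ V

section Frame

variable {a ε₁ ε₂ G : ℝ} {V V₁ V₂ : LVF}

lemma C_one_div_mul_C (ha : a ≠ 0) : (C (1 / a) : PP) * C a = 1 := by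
  rw [← C_mul, one_div_mul_cancel ha, C_1]

lemma C_mul_speed (ha : a ≠ 0) : C (2 * a) * speed a ε₁ V = rho a ε₁ V := by
  rw [speed, ← mul_assoc, ← C_mul, mul_one_div_cancel (by simpa using ha), C_1, one_mul]

lemma rho_eq (ha : a ≠ 0) : rho a ε₁ V = 2 * C a * speed a ε₁ V := by
  rw [← C_mul_speed ha, C_mul, map_ofNat]

lemma C_mul_cancel_left (ha : a ≠ 0) {x y : PP} (h : C a * x = C a * y) : x = y :=
  mul_left_cancel₀ (by simpa using ha) h

lemma C_half_mul_two : (C (1 / 2) : PP) * 2 = 1 := by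
  rw [← map_ofNat (C : ℝ →+* PP) 2, ← C_mul]
  norm_num

lemma Dx_C_mul (c : ℝ) (x : PP) : Dx (C c * x) = C c * Dx x := by
  simp [Derivation.leibniz]

/-! ### Structure equations along the curve -/

lemma Dx_phi (ha : a ≠ 0) :
    Dx (phi a ε₁ V) = C a * alpha a ε₁ V - C a * speed a ε₁ V := by
  rw [alpha, rho_eq ha]
  linear_combination (-Dx (phi a ε₁ V) - C a * speed a ε₁ V) * C_one_div_mul_C ha
    - C a * C (1 / a) * C a * speed a ε₁ V * C_half_mul_two

lemma Dx_f (ha : a ≠ 0) (hε₁ : ε₁ = 1 ∨ ε₁ = -1) (h : isStar a ε₁ V) :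
    Dx V.f = k1 * V.h - k2 * V.l - alpha a ε₁ V - speed a ε₁ V := by
  have hr := rho_eq (ε₁ := ε₁) (V := V) ha
  rw [rho, Dx_phi ha, show Dx V.g = - C (ε₁ * a) * V.h from h] at hr
  apply C_mul_cancel_left ha
  rcases hε₁ with rfl | rfl <;>
    simp only [map_neg, map_one, one_mul, neg_mul, C_mul, map_ofNat] at hr ⊢ <;>
    linear_combination -hr

lemma Dx_h : Dx V.h = phi a ε₁ V - C a * V.f + C ε₁ * k1 * V.g := by
  rw [phi]; ring

lemma Dx_g (h : isStar a ε₁ V) : Dx V.g = - (C ε₁ * C a * V.h) := by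
  rw [show Dx V.g = - C (ε₁ * a) * V.h from h, C_mul]; ring

lemma Dx_l : Dx V.l = psi ε₂ V - C ε₂ * k2 * V.g := by
  rw [psi]; ring

lemma Dx_alpha (ha : a ≠ 0) :
    Dx (alpha a ε₁ V) =
      C a * beta a ε₁ ε₂ G V - k1 * phi a ε₁ V + k2 * psi ε₂ V + C G * V.g := by
  rw [beta]
  linear_combination (-(Dx (alpha a ε₁ V) + k1 * phi a ε₁ V - k2 * psi ε₂ V - C G * V.g))
    * C_one_div_mul_C ha

lemma Dx_psi (ha : a ≠ 0) : Dx (psi ε₂ V) = C a * sigma a ε₂ V := by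
  rw [sigma]
  linear_combination -(Dx (psi ε₂ V)) * C_one_div_mul_C ha

lemma delta_eq (ha : a ≠ 0) : delta a ε₁ ε₂ V = C a * tau a ε₁ ε₂ V := by
  rw [tau]
  linear_combination -(delta a ε₁ ε₂ V) * C_one_div_mul_C ha

lemma Dx_sigma (ha : a ≠ 0) :
    Dx (sigma a ε₂ V) =
      C a * tau a ε₁ ε₂ V - k1 * psi ε₂ V - C ε₁ * C ε₂ * k2 * phi a ε₁ V := by
  rw [← delta_eq ha, delta, sigma, Dx_C_mul, C_mul]
  ring

/-! ### The derivation attached to a vector field -/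

lemma vhat_k1 : vhat a ε₁ ε₂ G V k1 = vk1 a ε₁ ε₂ G V := by
  simp [vhat, k1, mkDerivation_X, vhatFun]

lemma vhat_k2 : vhat a ε₁ ε₂ G V k2 = vk2 a ε₁ ε₂ G V := by
  simp [vhat, k2, mkDerivation_X, vhatFun]

lemma vhat_X_succ (i : Fin 2) (m : ℕ) :
    vhat a ε₁ ε₂ G V (X (i, m + 1)) =
      Dx (vhat a ε₁ ε₂ G V (X (i, m))) + speed a ε₁ V * X (i, m + 1) := by
  simp [vhat, mkDerivation_X, vhatFun, speed]

lemma Dx_X (i : Fin 2) (m : ℕ) : Dx (X (i, m)) = X (i, m + 1) := by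
  simp [Dx, mkDerivation_X]

lemma Dx_vhat (x : PP) :
    Dx (vhat a ε₁ ε₂ G V x) = vhat a ε₁ ε₂ G V (Dx x) - speed a ε₁ V * Dx x := by
  have : ⁅Dx, vhat a ε₁ ε₂ G V⁆ = -(speed a ε₁ V • Dx) := by
    apply MvPolynomial.derivation_ext
    rintro ⟨i, m⟩
    simp [Derivation.commutator_apply, Dx_X, vhat_X_succ]
  have := DFunLike.congr_fun this x
  simp only [Derivation.commutator_apply, Derivation.neg_apply, Derivation.smul_apply,
    smul_eq_mul] at this
  linear_combination this

lemma Dx_beta (ha : a ≠ 0) (h : isStar a ε₁ V) :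
    Dx (beta a ε₁ ε₂ G V) =
      vhat a ε₁ ε₂ G V k1 - k1 * alpha a ε₁ V + k2 * sigma a ε₂ V
        - k1 * speed a ε₁ V - C G * C ε₁ * V.h := by
  have hα := congrArg Dx (Dx_alpha (V := V) (ε₁ := ε₁) (ε₂ := ε₂) (G := G) ha)
  have hA : (C (1 / a) : PP) * C a = 1 := C_one_div_mul_C ha
  have hE : (C (1 / (2 * a)) : PP) * (2 * C a) = 1 := by
    rw [← map_ofNat (C : ℝ →+* PP) 2, ← C_mul, C_one_div_mul_C (by simpa using ha)]
  have hA2 : (C (1 / a ^ 2) : PP) = C (1 / a) * C (1 / a) := by rw [← C_mul]; congr 1; ring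
  have h2 : Dx (2 : PP) = 0 := Dx.map_natCast 2
  rw [vhat_k1, vk1, rho_eq ha, hA2]
  simp only [map_add, map_sub, Derivation.leibniz, derivation_C, smul_eq_mul, h2, Dx_phi ha,
    Dx_psi ha, Dx_g h, C_mul, map_ofNat, mul_zero, add_zero] at hα ⊢
  generalize (C (1 / a) : PP) = B at *
  generalize (C (1 / (2 * a)) : PP) = E at *
  generalize (C a : PP) = A at *
  grind

lemma Dx_tau (ha : a ≠ 0) (hε₁ : ε₁ = 1 ∨ ε₁ = -1) (hε₂ : ε₂ = 1 ∨ ε₂ = -1) :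
    Dx (tau a ε₁ ε₂ V) =
      C ε₁ * C ε₂ * (vhat a ε₁ ε₂ G V k2 - k2 * alpha a ε₁ V - k2 * speed a ε₁ V)
        - k1 * sigma a ε₂ V + C ε₁ * C G * V.l := by
  have hσ := congrArg Dx (Dx_sigma (V := V) (ε₁ := ε₁) (ε₂ := ε₂) ha)
  have hA : (C (1 / a) : PP) * C a = 1 := C_one_div_mul_C ha
  have hA2 : (C (ε₁ * ε₂ / a ^ 2) : PP) = C ε₁ * C ε₂ * (C (1 / a) * C (1 / a)) := by
    simp only [← C_mul]; congr 1; ring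
  rw [vhat_k2, vk2, rho_eq ha, hA2, div_eq_mul_one_div (ε₁ * ε₂) a]
  simp only [map_sub, Derivation.leibniz, derivation_C, smul_eq_mul, Dx_phi ha, Dx_psi ha, C_mul,
    mul_zero, add_zero] at hσ ⊢
  generalize (C (1 / a) : PP) = B at *
  generalize (C a : PP) = A at *
  have e₁ : (C ε₁ : PP) * C ε₁ = 1 := by rcases hε₁ with rfl | rfl <;> simp
  have e₂ : (C ε₂ : PP) * C ε₂ = 1 := by rcases hε₂ with rfl | rfl <;> simp
  generalize (C ε₁ : PP) = e₁ at *
  generalize (C ε₂ : PP) = e₂ at *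
  grind

/-! ### Components of the bracket -/

lemma bracket_f : (bracket a ε₁ ε₂ G V₁ V₂).f =
    vhat a ε₁ ε₂ G V₁ V₂.f - alpha a ε₁ V₁ * V₂.f - beta a ε₁ ε₂ G V₁ * V₂.h
      + C ε₁ * C ε₂ * tau a ε₁ ε₂ V₁ * V₂.l
    - (vhat a ε₁ ε₂ G V₂ V₁.f - alpha a ε₁ V₂ * V₁.f - beta a ε₁ ε₂ G V₂ * V₁.h
      + C ε₁ * C ε₂ * tau a ε₁ ε₂ V₂ * V₁.l) := by
  change (DV a ε₁ ε₂ G V₁ V₂).f - (DV a ε₁ ε₂ G V₂ V₁).f = _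
  simp only [DV, tau, div_eq_mul_one_div (ε₁ * ε₂) a, div_eq_mul_one_div ε₁ a, C_mul]
  ring

lemma bracket_h : (bracket a ε₁ ε₂ G V₁ V₂).h =
    vhat a ε₁ ε₂ G V₁ V₂.h + phi a ε₁ V₁ * V₂.f - C ε₁ * beta a ε₁ ε₂ G V₁ * V₂.g
      - C ε₁ * C ε₂ * sigma a ε₂ V₁ * V₂.l
    - (vhat a ε₁ ε₂ G V₂ V₁.h + phi a ε₁ V₂ * V₁.f - C ε₁ * beta a ε₁ ε₂ G V₂ * V₁.g
      - C ε₁ * C ε₂ * sigma a ε₂ V₂ * V₁.l) := by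
  change (DV a ε₁ ε₂ G V₁ V₂).h - (DV a ε₁ ε₂ G V₂ V₁).h = _
  simp only [DV, sigma, div_eq_mul_one_div (ε₁ * ε₂) a, div_eq_mul_one_div ε₁ a, C_mul]
  ring

lemma bracket_g : (bracket a ε₁ ε₂ G V₁ V₂).g =
    vhat a ε₁ ε₂ G V₁ V₂.g + C ε₁ * phi a ε₁ V₁ * V₂.h + alpha a ε₁ V₁ * V₂.g
      + C ε₂ * psi ε₂ V₁ * V₂.l
    - (vhat a ε₁ ε₂ G V₂ V₁.g + C ε₁ * phi a ε₁ V₂ * V₁.h + alpha a ε₁ V₂ * V₁.g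
      + C ε₂ * psi ε₂ V₂ * V₁.l) := rfl

lemma bracket_l : (bracket a ε₁ ε₂ G V₁ V₂).l =
    vhat a ε₁ ε₂ G V₁ V₂.l + psi ε₂ V₁ * V₂.f + sigma a ε₂ V₁ * V₂.h
      + C ε₁ * tau a ε₁ ε₂ V₁ * V₂.g
    - (vhat a ε₁ ε₂ G V₂ V₁.l + psi ε₂ V₂ * V₁.f + sigma a ε₂ V₂ * V₁.h
      + C ε₁ * tau a ε₁ ε₂ V₂ * V₁.g) := by
  change (DV a ε₁ ε₂ G V₁ V₂).l - (DV a ε₁ ε₂ G V₂ V₁).l = _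
  simp only [DV, sigma, tau, div_eq_mul_one_div (ε₁ * ε₂) a, div_eq_mul_one_div ε₁ a, C_mul]
  ring

lemma isStar_bracket (ha : a ≠ 0) (hε₁ : ε₁ = 1 ∨ ε₁ = -1) (hε₂ : ε₂ = 1 ∨ ε₂ = -1)
    (h₁ : isStar a ε₁ V₁) (h₂ : isStar a ε₁ V₂) :
    isStar a ε₁ (bracket a ε₁ ε₂ G V₁ V₂) := by
  rw [isStar, bracket_g, bracket_h, C_mul]
  simp only [map_add, map_sub, map_neg, Derivation.leibniz, derivation_C, smul_eq_mul, Dx_vhat,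
    Dx_h (a := a) (ε₁ := ε₁) (V := V₁), Dx_h (a := a) (ε₁ := ε₁) (V := V₂), Dx_g h₁, Dx_g h₂,
    Dx_l (ε₂ := ε₂) (V := V₁), Dx_l (ε₂ := ε₂) (V := V₂), Dx_phi ha,
    Dx_alpha (ε₂ := ε₂) (G := G) ha, Dx_psi ha]
  rcases hε₁ with rfl | rfl <;> rcases hε₂ with rfl | rfl <;>
    simp only [map_neg, map_one] <;> ring

lemma phi_bracket (ha : a ≠ 0) (hε₁ : ε₁ = 1 ∨ ε₁ = -1) (hε₂ : ε₂ = 1 ∨ ε₂ = -1)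
    (h₁ : isStar a ε₁ V₁) (h₂ : isStar a ε₁ V₂) :
    phi a ε₁ (bracket a ε₁ ε₂ G V₁ V₂) =
      vhat a ε₁ ε₂ G V₁ (phi a ε₁ V₂) - vhat a ε₁ ε₂ G V₂ (phi a ε₁ V₁)
      - (phi a ε₁ V₁ * alpha a ε₁ V₂ - phi a ε₁ V₂ * alpha a ε₁ V₁)
      - C ε₁ * C ε₂ * (sigma a ε₂ V₁ * psi ε₂ V₂ - sigma a ε₂ V₂ * psi ε₂ V₁)
      + C G * (V₁.h * V₂.g - V₂.h * V₁.g) := by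
  rw [phi, bracket_f, bracket_h, bracket_g]
  simp only [map_add, map_sub, Derivation.leibniz, derivation_C, smul_eq_mul, Dx_vhat,
    Dx_f ha hε₁ h₁, Dx_f ha hε₁ h₂, Dx_h (a := a) (ε₁ := ε₁) (V := V₁),
    Dx_h (a := a) (ε₁ := ε₁) (V := V₂), Dx_g h₁, Dx_g h₂, Dx_l (ε₂ := ε₂) (V := V₁),
    Dx_l (ε₂ := ε₂) (V := V₂), Dx_phi ha, Dx_sigma (ε₁ := ε₁) ha, Dx_beta ha h₁, Dx_beta ha h₂]
  rcases hε₁ with rfl | rfl <;> rcases hε₂ with rfl | rfl <;>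
    simp only [map_neg, map_one] <;> ring

lemma psi_bracket (ha : a ≠ 0) (hε₁ : ε₁ = 1 ∨ ε₁ = -1) (hε₂ : ε₂ = 1 ∨ ε₂ = -1)
    (h₁ : isStar a ε₁ V₁) (h₂ : isStar a ε₁ V₂) :
    psi ε₂ (bracket a ε₁ ε₂ G V₁ V₂) =
      vhat a ε₁ ε₂ G V₁ (psi ε₂ V₂) - vhat a ε₁ ε₂ G V₂ (psi ε₂ V₁)
      - (psi ε₂ V₁ * alpha a ε₁ V₂ - psi ε₂ V₂ * alpha a ε₁ V₁)
      + (sigma a ε₂ V₁ * phi a ε₁ V₂ - sigma a ε₂ V₂ * phi a ε₁ V₁)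
      + C G * (V₁.l * V₂.g - V₂.l * V₁.g) := by
  rw [psi, bracket_l, bracket_g]
  simp only [map_add, map_sub, Derivation.leibniz, derivation_C, smul_eq_mul, Dx_vhat,
    Dx_f ha hε₁ h₁, Dx_f ha hε₁ h₂, Dx_h (a := a) (ε₁ := ε₁) (V := V₁),
    Dx_h (a := a) (ε₁ := ε₁) (V := V₂), Dx_g h₁, Dx_g h₂, Dx_l (ε₂ := ε₂) (V := V₁),
    Dx_l (ε₂ := ε₂) (V := V₂), Dx_psi ha, Dx_sigma (ε₁ := ε₁) ha, Dx_tau (G := G) ha hε₁ hε₂]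
  rcases hε₁ with rfl | rfl <;> rcases hε₂ with rfl | rfl <;>
    simp only [map_neg, map_one] <;> ring

lemma speed_bracket (ha : a ≠ 0) (hε₁ : ε₁ = 1 ∨ ε₁ = -1) (hε₂ : ε₂ = 1 ∨ ε₂ = -1)
    (h₁ : isStar a ε₁ V₁) (h₂ : isStar a ε₁ V₂) :
    speed a ε₁ (bracket a ε₁ ε₂ G V₁ V₂) =
      vhat a ε₁ ε₂ G V₁ (speed a ε₁ V₂) - vhat a ε₁ ε₂ G V₂ (speed a ε₁ V₁) := by
  apply C_mul_cancel_left (a := 2 * a) (by simpa using ha)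
  rw [C_mul_speed ha, rho, Dx_g (isStar_bracket ha hε₁ hε₂ h₁ h₂), phi_bracket ha hε₁ hε₂ h₁ h₂,
    bracket_f, bracket_h, bracket_l, C_mul, map_ofNat]
  simp only [map_add, map_sub, Derivation.leibniz, derivation_C, smul_eq_mul, Dx_vhat,
    Dx_f ha hε₁ h₁, Dx_f ha hε₁ h₂, Dx_h (a := a) (ε₁ := ε₁) (V := V₁),
    Dx_h (a := a) (ε₁ := ε₁) (V := V₂), Dx_g h₁, Dx_g h₂, Dx_l (ε₂ := ε₂) (V := V₁),
    Dx_l (ε₂ := ε₂) (V := V₂), Dx_phi ha, Dx_alpha (ε₂ := ε₂) (G := G) ha, Dx_psi ha,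
    Dx_sigma (ε₁ := ε₁) ha, Dx_beta ha h₁, Dx_beta ha h₂, Dx_tau (G := G) ha hε₁ hε₂]
  rcases hε₁ with rfl | rfl <;> rcases hε₂ with rfl | rfl <;>
    simp only [map_neg, map_one] <;> ring

lemma alpha_bracket (ha : a ≠ 0) (hε₁ : ε₁ = 1 ∨ ε₁ = -1) (hε₂ : ε₂ = 1 ∨ ε₂ = -1)
    (h₁ : isStar a ε₁ V₁) (h₂ : isStar a ε₁ V₂) :
    alpha a ε₁ (bracket a ε₁ ε₂ G V₁ V₂) =
      vhat a ε₁ ε₂ G V₁ (alpha a ε₁ V₂) - vhat a ε₁ ε₂ G V₂ (alpha a ε₁ V₁)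
      + (beta a ε₁ ε₂ G V₁ * phi a ε₁ V₂ - beta a ε₁ ε₂ G V₂ * phi a ε₁ V₁)
      - C ε₁ * C ε₂ * (tau a ε₁ ε₂ V₁ * psi ε₂ V₂ - tau a ε₁ ε₂ V₂ * psi ε₂ V₁)
      - C G * (V₁.f * V₂.g - V₂.f * V₁.g) := by
  apply C_mul_cancel_left ha
  rw [show C a * alpha a ε₁ (bracket a ε₁ ε₂ G V₁ V₂) =
      Dx (phi a ε₁ (bracket a ε₁ ε₂ G V₁ V₂))
      + C a * speed a ε₁ (bracket a ε₁ ε₂ G V₁ V₂) by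
    rw [Dx_phi ha]; ring,
    phi_bracket ha hε₁ hε₂ h₁ h₂, speed_bracket ha hε₁ hε₂ h₁ h₂]
  simp only [map_add, map_sub, Derivation.leibniz, derivation_C, smul_eq_mul, Dx_vhat,
    Dx_h (a := a) (ε₁ := ε₁) (V := V₁), Dx_h (a := a) (ε₁ := ε₁) (V := V₂), Dx_g h₁, Dx_g h₂,
    Dx_phi ha, Dx_alpha (ε₂ := ε₂) (G := G) ha, Dx_psi ha, Dx_sigma (ε₁ := ε₁) ha]
  rcases hε₁ with rfl | rfl <;> rcases hε₂ with rfl | rfl <;>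
    simp only [map_neg, map_one] <;> ring

lemma sigma_bracket (ha : a ≠ 0) (hε₁ : ε₁ = 1 ∨ ε₁ = -1) (hε₂ : ε₂ = 1 ∨ ε₂ = -1)
    (h₁ : isStar a ε₁ V₁) (h₂ : isStar a ε₁ V₂) :
    sigma a ε₂ (bracket a ε₁ ε₂ G V₁ V₂) =
      vhat a ε₁ ε₂ G V₁ (sigma a ε₂ V₂) - vhat a ε₁ ε₂ G V₂ (sigma a ε₂ V₁)
      + (tau a ε₁ ε₂ V₁ * phi a ε₁ V₂ - tau a ε₁ ε₂ V₂ * phi a ε₁ V₁)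
      - (psi ε₂ V₁ * beta a ε₁ ε₂ G V₂ - psi ε₂ V₂ * beta a ε₁ ε₂ G V₁)
      - C ε₁ * C G * (V₁.l * V₂.h - V₂.l * V₁.h) := by
  apply C_mul_cancel_left ha
  rw [← Dx_psi ha, psi_bracket ha hε₁ hε₂ h₁ h₂]
  simp only [map_add, map_sub, Derivation.leibniz, derivation_C, smul_eq_mul, Dx_vhat, Dx_g h₁,
    Dx_g h₂, Dx_l (ε₂ := ε₂) (V := V₁), Dx_l (ε₂ := ε₂) (V := V₂), Dx_phi ha,
    Dx_alpha (ε₂ := ε₂) (G := G) ha, Dx_psi ha, Dx_sigma (ε₁ := ε₁) ha]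
  rcases hε₁ with rfl | rfl <;> rcases hε₂ with rfl | rfl <;>
    simp only [map_neg, map_one] <;> ring

lemma beta_bracket (ha : a ≠ 0) (hε₁ : ε₁ = 1 ∨ ε₁ = -1) (hε₂ : ε₂ = 1 ∨ ε₂ = -1)
    (h₁ : isStar a ε₁ V₁) (h₂ : isStar a ε₁ V₂) :
    beta a ε₁ ε₂ G (bracket a ε₁ ε₂ G V₁ V₂) =
      vhat a ε₁ ε₂ G V₁ (beta a ε₁ ε₂ G V₂) - vhat a ε₁ ε₂ G V₂ (beta a ε₁ ε₂ G V₁)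
      - (alpha a ε₁ V₁ * beta a ε₁ ε₂ G V₂ - alpha a ε₁ V₂ * beta a ε₁ ε₂ G V₁)
      - C ε₁ * C ε₂ * (tau a ε₁ ε₂ V₁ * sigma a ε₂ V₂ - tau a ε₁ ε₂ V₂ * sigma a ε₂ V₁)
      + C ε₁ * C G * (V₁.f * V₂.h - V₂.f * V₁.h) := by
  apply C_mul_cancel_left ha
  rw [show C a * beta a ε₁ ε₂ G (bracket a ε₁ ε₂ G V₁ V₂) =
      Dx (alpha a ε₁ (bracket a ε₁ ε₂ G V₁ V₂))
      + k1 * phi a ε₁ (bracket a ε₁ ε₂ G V₁ V₂)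
      - k2 * psi ε₂ (bracket a ε₁ ε₂ G V₁ V₂) - C G * (bracket a ε₁ ε₂ G V₁ V₂).g by
    rw [Dx_alpha (ε₂ := ε₂) (G := G) ha]; ring,
    alpha_bracket ha hε₁ hε₂ h₁ h₂,
    phi_bracket ha hε₁ hε₂ h₁ h₂,
    psi_bracket ha hε₁ hε₂ h₁ h₂, bracket_g]
  simp only [map_add, map_sub, Derivation.leibniz, derivation_C, smul_eq_mul, Dx_vhat,
    Dx_f ha hε₁ h₁, Dx_f ha hε₁ h₂, Dx_g h₁, Dx_g h₂, Dx_phi ha, Dx_alpha (ε₂ := ε₂) (G := G) ha,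
    Dx_psi ha, Dx_beta ha h₁, Dx_beta ha h₂, Dx_tau (G := G) ha hε₁ hε₂]
  rcases hε₁ with rfl | rfl <;> rcases hε₂ with rfl | rfl <;>
    simp only [map_neg, map_one] <;> ring

lemma tau_bracket (ha : a ≠ 0) (hε₁ : ε₁ = 1 ∨ ε₁ = -1) (hε₂ : ε₂ = 1 ∨ ε₂ = -1)
    (h₁ : isStar a ε₁ V₁) (h₂ : isStar a ε₁ V₂) :
    tau a ε₁ ε₂ (bracket a ε₁ ε₂ G V₁ V₂) =
      vhat a ε₁ ε₂ G V₁ (tau a ε₁ ε₂ V₂) - vhat a ε₁ ε₂ G V₂ (tau a ε₁ ε₂ V₁)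
      - (sigma a ε₂ V₁ * beta a ε₁ ε₂ G V₂ - sigma a ε₂ V₂ * beta a ε₁ ε₂ G V₁)
      + (tau a ε₁ ε₂ V₁ * alpha a ε₁ V₂ - tau a ε₁ ε₂ V₂ * alpha a ε₁ V₁)
      + C ε₁ * C G * (V₁.l * V₂.f - V₂.l * V₁.f) := by
  apply C_mul_cancel_left ha
  rw [show C a * tau a ε₁ ε₂ (bracket a ε₁ ε₂ G V₁ V₂) =
      Dx (sigma a ε₂ (bracket a ε₁ ε₂ G V₁ V₂))
      + k1 * psi ε₂ (bracket a ε₁ ε₂ G V₁ V₂)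
      + C ε₁ * C ε₂ * k2 * phi a ε₁ (bracket a ε₁ ε₂ G V₁ V₂) by
    rw [Dx_sigma (ε₁ := ε₁) ha]; ring,
    sigma_bracket ha hε₁ hε₂ h₁ h₂, phi_bracket ha hε₁ hε₂ h₁ h₂,
    psi_bracket ha hε₁ hε₂ h₁ h₂]
  simp only [map_add, map_sub, Derivation.leibniz, derivation_C, smul_eq_mul, Dx_vhat,
    Dx_h (a := a) (ε₁ := ε₁) (V := V₁), Dx_h (a := a) (ε₁ := ε₁) (V := V₂),
    Dx_l (ε₂ := ε₂) (V := V₁), Dx_l (ε₂ := ε₂) (V := V₂), Dx_phi ha, Dx_psi ha,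
    Dx_sigma (ε₁ := ε₁) ha, Dx_beta ha h₁, Dx_beta ha h₂, Dx_tau (G := G) ha hε₁ hε₂]
  rcases hε₁ with rfl | rfl <;> rcases hε₂ with rfl | rfl <;>
    simp only [map_neg, map_one] <;> ring

lemma vhat_bracket_k1 (ha : a ≠ 0) (hε₁ : ε₁ = 1 ∨ ε₁ = -1) (hε₂ : ε₂ = 1 ∨ ε₂ = -1)
    (h₁ : isStar a ε₁ V₁) (h₂ : isStar a ε₁ V₂) :
    vhat a ε₁ ε₂ G (bracket a ε₁ ε₂ G V₁ V₂) k1 =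
      vhat a ε₁ ε₂ G V₁ (vhat a ε₁ ε₂ G V₂ k1) - vhat a ε₁ ε₂ G V₂ (vhat a ε₁ ε₂ G V₁ k1) := by
  rw [show vhat a ε₁ ε₂ G (bracket a ε₁ ε₂ G V₁ V₂) k1 =
      Dx (beta a ε₁ ε₂ G (bracket a ε₁ ε₂ G V₁ V₂))
      + k1 * alpha a ε₁ (bracket a ε₁ ε₂ G V₁ V₂)
      - k2 * sigma a ε₂ (bracket a ε₁ ε₂ G V₁ V₂)
      + k1 * speed a ε₁ (bracket a ε₁ ε₂ G V₁ V₂)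
      + C G * C ε₁ * (bracket a ε₁ ε₂ G V₁ V₂).h by
    rw [Dx_beta ha (isStar_bracket ha hε₁ hε₂ h₁ h₂)]; ring,
    beta_bracket ha hε₁ hε₂ h₁ h₂, alpha_bracket ha hε₁ hε₂ h₁ h₂,
    sigma_bracket ha hε₁ hε₂ h₁ h₂, speed_bracket ha hε₁ hε₂ h₁ h₂, bracket_h]
  simp only [map_add, map_sub, Derivation.leibniz, derivation_C, smul_eq_mul, Dx_vhat,
    Dx_f ha hε₁ h₁, Dx_f ha hε₁ h₂, Dx_h (a := a) (ε₁ := ε₁) (V := V₁),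
    Dx_h (a := a) (ε₁ := ε₁) (V := V₂), Dx_alpha (ε₂ := ε₂) (G := G) ha, Dx_sigma (ε₁ := ε₁) ha,
    Dx_beta ha h₁, Dx_beta ha h₂, Dx_tau (G := G) ha hε₁ hε₂]
  rcases hε₁ with rfl | rfl <;> rcases hε₂ with rfl | rfl <;>
    simp only [map_neg, map_one] <;> ring

lemma vhat_bracket_k2 (ha : a ≠ 0) (hε₁ : ε₁ = 1 ∨ ε₁ = -1) (hε₂ : ε₂ = 1 ∨ ε₂ = -1)
    (h₁ : isStar a ε₁ V₁) (h₂ : isStar a ε₁ V₂) :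
    vhat a ε₁ ε₂ G (bracket a ε₁ ε₂ G V₁ V₂) k2 =
      vhat a ε₁ ε₂ G V₁ (vhat a ε₁ ε₂ G V₂ k2) - vhat a ε₁ ε₂ G V₂ (vhat a ε₁ ε₂ G V₁ k2) := by
  rw [show vhat a ε₁ ε₂ G (bracket a ε₁ ε₂ G V₁ V₂) k2 =
      C ε₁ * C ε₂ * (Dx (tau a ε₁ ε₂ (bracket a ε₁ ε₂ G V₁ V₂))
      + k1 * sigma a ε₂ (bracket a ε₁ ε₂ G V₁ V₂) - C ε₁ * C G * (bracket a ε₁ ε₂ G V₁ V₂).l)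
      + k2 * alpha a ε₁ (bracket a ε₁ ε₂ G V₁ V₂)
      + k2 * speed a ε₁ (bracket a ε₁ ε₂ G V₁ V₂) by
    rw [Dx_tau (G := G) ha hε₁ hε₂]
    rcases hε₁ with rfl | rfl <;> rcases hε₂ with rfl | rfl <;>
      simp only [map_neg, map_one] <;> ring,
    tau_bracket ha hε₁ hε₂ h₁ h₂, alpha_bracket ha hε₁ hε₂ h₁ h₂,
    sigma_bracket ha hε₁ hε₂ h₁ h₂, speed_bracket ha hε₁ hε₂ h₁ h₂, bracket_l]
  simp only [map_add, map_sub, Derivation.leibniz, derivation_C, smul_eq_mul, Dx_vhat,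
    Dx_f ha hε₁ h₁, Dx_f ha hε₁ h₂, Dx_l (ε₂ := ε₂) (V := V₁), Dx_l (ε₂ := ε₂) (V := V₂),
    Dx_alpha (ε₂ := ε₂) (G := G) ha, Dx_sigma (ε₁ := ε₁) ha, Dx_beta ha h₁, Dx_beta ha h₂,
    Dx_tau (G := G) ha hε₁ hε₂]
  rcases hε₁ with rfl | rfl <;> rcases hε₂ with rfl | rfl <;>
    simp only [map_neg, map_one] <;> ring

theorem vhat_bracket (ha : a ≠ 0) (hε₁ : ε₁ = 1 ∨ ε₁ = -1) (hε₂ : ε₂ = 1 ∨ ε₂ = -1)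
    (h₁ : isStar a ε₁ V₁) (h₂ : isStar a ε₁ V₂) :
    vhat a ε₁ ε₂ G (bracket a ε₁ ε₂ G V₁ V₂) = ⁅vhat a ε₁ ε₂ G V₁, vhat a ε₁ ε₂ G V₂⁆ := by
  apply MvPolynomial.derivation_ext
  rintro ⟨i, m⟩
  rw [Derivation.commutator_apply]
  induction m with
  | zero =>
    fin_cases i
    · exact vhat_bracket_k1 ha hε₁ hε₂ h₁ h₂
    · exact vhat_bracket_k2 ha hε₁ hε₂ h₁ h₂
  | succ m ih =>
    simp only [vhat_X_succ, ih, speed_bracket ha hε₁ hε₂ h₁ h₂, map_add, map_sub,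
      Derivation.leibniz, smul_eq_mul, Dx_vhat (vhat a ε₁ ε₂ G V₁ _),
      Dx_vhat (vhat a ε₁ ε₂ G V₂ _)]
    ring

end Frame

end LVF

/-- The derivation attached to the bracket is the commutator of the
attached derivations. -/
theorem stmt9 (a ε₁ ε₂ G : ℝ) (ha : a ≠ 0) (hε₁ : ε₁ = 1 ∨ ε₁ = -1)
    (hε₂ : ε₂ = 1 ∨ ε₂ = -1) (V₁ V₂ : LVF)
    (h₁ : LVF.isStar a ε₁ V₁) (h₂ : LVF.isStar a ε₁ V₂) :
    ∀ f : PP,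
      LVF.vhat a ε₁ ε₂ G (LVF.bracket a ε₁ ε₂ G V₁ V₂) f =
        LVF.vhat a ε₁ ε₂ G V₁ (LVF.vhat a ε₁ ε₂ G V₂ f)
          - LVF.vhat a ε₁ ε₂ G V₂ (LVF.vhat a ε₁ ε₂ G V₁ f) := by
  intro f
  rw [LVF.vhat_bracket ha hε₁ hε₂ h₁ h₂, Derivation.commutator_apply]
end
end
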